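/- arXiv:math/0503518 — 4 statements merged into one kernel-verified Lean document; each statement's English description precedes it below -/
import Mathlib

section
/- There exist finite multisets A_i (i ∈ I) and B_j (j ∈ J), possibly empty, with all elements belonging to {μ_ij : (i,j) ∈ E}, depending only on I, J, E and μ, such that the following holds: whenever continuous functions y_i, w_i : [0,∞) → ℝ (i ∈ I), z_j : [0,∞) → ℝ (j ∈ J) and ψ_ij : [0,∞) → ℝ (with ψ_ij ≡ 0 for (i,j) ∉ E) satisfy ∑_{j∈J} (𝔗_{μ_ij} ψ_ij)(t) = w_i(t) − (𝔗_{θ_i} y_i)(t) for each i ∈ I and ∑_{i∈I} ψ_ij(t) = −z_j(t) for each j ∈ J and all t ≥ 0, then for all t ≥ 0: ∑_{i∈I} (𝔗_{A_i} w_i)(t) − ∑_{i∈I} (𝔗_{A_i}(𝔗_{θ_i} y_i))(t) + ∑_{j∈J} (𝔗_{B_j} z_j)(t) = 0, where for a finite multiset A of reals, 𝔗_A denotes the composition of the operators 𝔗_α over α ∈ A (well defined in any order since these operators commute). -/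
open MeasureTheory Set

/-- `(𝔍 f) t = ∫₀ᵗ f(s) ds`. -/
noncomputable def 𝔍 (f : ℝ → ℝ) (t : ℝ) : ℝ := ∫ s in (0:ℝ)..t, f s

/-- `(𝔗_α f)(t) = f(t) + α (𝔍 f)(t)`. -/
noncomputable def 𝔗 (α : ℝ) (f : ℝ → ℝ) : ℝ → ℝ := fun t => f t + α * 𝔍 f t

/-- `𝔗_A`, the composition of the operators `𝔗_α` over the finite family `A`
(listed in some order; on the relevant functions the operators commute, so the
order is immaterial). -/
noncomputable def 𝔗l (A : List ℝ) (f : ℝ → ℝ) : ℝ → ℝ := A.foldr 𝔗 f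

/-- The bipartite graph on `I ⊕ J` with an edge between `i : I` and `j : J`
iff `(i, j) ∈ E`. -/
def actGraph {I J : Type*} (E : Set (I × J)) : SimpleGraph (I ⊕ J) :=
  SimpleGraph.fromRel (fun a b => ∃ i j, a = Sum.inl i ∧ b = Sum.inr j ∧ (i, j) ∈ E)

/-- The Volterra operator `𝔍` as a linear endomorphism of the continuous functions. -/
noncomputable def volterra : Module.End ℝ C(ℝ, ℝ) where
  toFun f := ⟨𝔍 f, intervalIntegral.continuous_primitive
    (fun a b => f.continuous.intervalIntegrable a b) 0⟩
  map_add' f g := by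
    ext t
    exact intervalIntegral.integral_add (f.continuous.intervalIntegrable 0 t)
      (g.continuous.intervalIntegrable 0 t)
  map_smul' c f := by
    ext t
    exact intervalIntegral.integral_const_mul c f

/-- The operator `𝔗_α` as a linear endomorphism of the continuous functions. -/
noncomputable def volterraShift (α : ℝ) : Module.End ℝ C(ℝ, ℝ) := 1 + α • volterra

lemma coe_volterraShift (α : ℝ) (f : C(ℝ, ℝ)) : ⇑(volterraShift α f) = 𝔗 α f := rfl

lemma commute_volterraShift (α β : ℝ) : Commute (volterraShift α) (volterraShift β) :=
  ((Commute.one_right _).add_right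
    (((Commute.one_left _).add_left ((Commute.refl volterra).smul_left α)).smul_right β))

lemma coe_prod_volterraShift (A : List ℝ) (f : C(ℝ, ℝ)) :
    ⇑((A.map volterraShift).prod f) = 𝔗l A f := by
  induction A with
  | nil => rfl
  | cons a A ih =>
    rw [List.map_cons, List.prod_cons, Module.End.mul_apply, coe_volterraShift, ih]
    rfl

lemma prod_volterraShift_perm {A B : List ℝ} (h : A.Perm B) :
    (A.map volterraShift).prod = (B.map volterraShift).prod :=
  (h.map volterraShift).prod_eq' <| List.pairwise_map.2 <|
    List.pairwise_of_forall fun a b => commute_volterraShift a b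

lemma eqOn_𝔗 (α : ℝ) {f g : ℝ → ℝ} (h : EqOn f g (Ici 0)) : EqOn (𝔗 α f) (𝔗 α g) (Ici 0) := by
  intro t ht
  have : 𝔍 f t = 𝔍 g t := intervalIntegral.integral_congr fun s hs => by
    rw [uIcc_of_le ht] at hs
    exact h hs.1
  simp only [𝔗, h ht, this]

lemma eqOn_𝔗l (A : List ℝ) {f g : ℝ → ℝ} (h : EqOn f g (Ici 0)) :
    EqOn (𝔗l A f) (𝔗l A g) (Ici 0) := by
  induction A with
  | nil => exact h
  | cons a A ih => exact eqOn_𝔗 a ih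

lemma actGraph_adj {I J : Type*} {E : Set (I × J)} {i : I} {j : J} :
    (actGraph E).Adj (Sum.inl i) (Sum.inr j) ↔ (i, j) ∈ E := by
  simp [actGraph, SimpleGraph.fromRel_adj]

open Classical in
/-- The edges `p ∈ E` of the bipartite graph such that `v` is still connected to the `J`-endpoint
of `p` after `p` is deleted. -/
noncomputable def edgesTowards {I J : Type*} [Fintype I] [Fintype J] (E : Set (I × J))
    (v : I ⊕ J) : Finset (I × J) :=
  {p | p ∈ E ∧ ((actGraph E).deleteEdges {s(Sum.inl p.1, Sum.inr p.2)}).Reachable v (Sum.inr p.2)}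

lemma mem_edgesTowards {I J : Type*} [Fintype I] [Fintype J] {E : Set (I × J)} {v : I ⊕ J}
    {p : I × J} : p ∈ edgesTowards E v ↔ p ∈ E ∧
      ((actGraph E).deleteEdges {s(Sum.inl p.1, Sum.inr p.2)}).Reachable v (Sum.inr p.2) := by
  simp [edgesTowards]

lemma notMem_edgesTowards_inl {I J : Type*} [Fintype I] [Fintype J] {E : Set (I × J)}
    (hE : (actGraph E).IsAcyclic) {i : I} {j : J} (hij : (i, j) ∈ E) :
    (i, j) ∉ edgesTowards E (Sum.inl i) := fun h =>
  SimpleGraph.isBridge_iff.1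
    (SimpleGraph.isAcyclic_iff_forall_adj_isBridge.1 hE (actGraph_adj.2 hij))
    (mem_edgesTowards.1 h).2

lemma edgesTowards_inr {I J : Type*} [Fintype I] [Fintype J] {E : Set (I × J)}
    (hE : (actGraph E).IsAcyclic) {i : I} {j : J} (hij : (i, j) ∈ E) :
    edgesTowards E (Sum.inr j) =
      (edgesTowards E (Sum.inl i)).cons (i, j) (notMem_edgesTowards_inl hE hij) := by
  ext p
  rw [Finset.mem_cons]
  by_cases hp : p = (i, j)
  · subst hp
    simpa [mem_edgesTowards] using hij
  · have hadj : ((actGraph E).deleteEdges {s(Sum.inl p.1, Sum.inr p.2)}).Adj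
        (Sum.inl i) (Sum.inr j) := by
      rw [SimpleGraph.deleteEdges_adj]
      refine ⟨actGraph_adj.2 hij, ?_⟩
      intro h
      simp only [mem_singleton_iff, Sym2.eq_iff, Sum.inl.injEq, Sum.inr.injEq, reduceCtorEq,
        and_self, or_false] at h
      exact hp (Prod.ext h.1.symm h.2.symm)
    simp only [hp, false_or, mem_edgesTowards]
    exact and_congr_right fun _ => ⟨hadj.reachable.trans, hadj.symm.reachable.trans⟩

/-- Theorem 2(i): there exist finite families `A_i`, `B_j` with values in
`{μ_ij : (i,j) ∈ E}`, depending only on the structural data, such that every solution of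
(49)–(50) satisfies the integral equation
`∑_i 𝔗_{A_i} w_i − ∑_i 𝔗_{A_i}(𝔗_{θ_i} y_i) + ∑_j 𝔗_{B_j} z_j = 0`. -/
theorem integral_formula_exists
    {I J : Type*} [Fintype I] [Fintype J] [Nonempty I] [Nonempty J]
    (E : Set (I × J)) (μ : I × J → ℝ) (θ : I → ℝ)
    (htree : (actGraph E).IsTree)
    (hμpos : ∀ p ∈ E, 0 < μ p) (hμzero : ∀ p : I × J, p ∉ E → μ p = 0)
    (hθ : ∀ i, 0 ≤ θ i) :
    ∃ (A : I → List ℝ) (B : J → List ℝ),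
      (∀ i, ∀ a ∈ A i, ∃ p ∈ E, a = μ p) ∧
      (∀ j, ∀ b ∈ B j, ∃ p ∈ E, b = μ p) ∧
      ∀ (y w : I → ℝ → ℝ) (z : J → ℝ → ℝ) (ψ : I → J → ℝ → ℝ),
        (∀ i, Continuous (y i)) → (∀ i, Continuous (w i)) →
        (∀ j, Continuous (z j)) → (∀ i j, Continuous (ψ i j)) →
        (∀ i j, (i, j) ∉ E → ψ i j = 0) →
        (∀ i, ∀ t : ℝ, 0 ≤ t →
          ∑ j, 𝔗 (μ (i, j)) (ψ i j) t = w i t - 𝔗 (θ i) (y i) t) →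
        (∀ j, ∀ t : ℝ, 0 ≤ t → ∑ i, ψ i j t = - z j t) →
        ∀ t : ℝ, 0 ≤ t →
          ∑ i, 𝔗l (A i) (w i) t - ∑ i, 𝔗l (A i) (𝔗 (θ i) (y i)) t
            + ∑ j, 𝔗l (B j) (z j) t = 0 := by
  let S : I ⊕ J → List ℝ := fun v => (edgesTowards E v).toList.map μ
  have hSmem : ∀ v, ∀ a ∈ S v, ∃ p ∈ E, a = μ p := by
    intro v a ha
    obtain ⟨p, hp, rfl⟩ := List.mem_map.1 ha
    exact ⟨p, (mem_edgesTowards.1 (Finset.mem_toList.1 hp)).1, rfl⟩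
  have hperm : ∀ i j, (i, j) ∈ E → (S (Sum.inr j)).Perm (μ (i, j) :: S (Sum.inl i)) := by
    intro i j hij
    have h := (Finset.toList_cons (notMem_edgesTowards_inl htree.isAcyclic hij)).map μ
    rwa [← edgesTowards_inr htree.isAcyclic hij] at h
  refine ⟨fun i => S (Sum.inl i), fun j => S (Sum.inr j), fun i => hSmem _, fun j => hSmem _, ?_⟩
  intro y w z ψ hy hw hz hψ hψ0 hrow hcol t ht
  lift y to I → C(ℝ, ℝ) using hy
  lift z to J → C(ℝ, ℝ) using hz
  let Ψ : I → J → C(ℝ, ℝ) := fun i j => ⟨ψ i j, hψ i j⟩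
  let P : I ⊕ J → Module.End ℝ C(ℝ, ℝ) := fun v => ((S v).map volterraShift).prod
  have hP : ∀ i j, P (Sum.inl i) (volterraShift (μ (i, j)) (Ψ i j)) = P (Sum.inr j) (Ψ i j) := by
    intro i j
    by_cases hij : (i, j) ∈ E
    · have h : P (Sum.inr j) = P (Sum.inl i) * volterraShift (μ (i, j)) := by
        simp only [P, prod_volterraShift_perm
          ((hperm i j hij).trans (List.perm_append_singleton _ _).symm)]
        simp
      rw [h, Module.End.mul_apply]
    · have h : Ψ i j = 0 := by
        ext s
        simp [Ψ, hψ0 i j hij]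
      simp [h]
  have hA : ∀ i, 𝔗l (S (Sum.inl i)) (w i) t - 𝔗l (S (Sum.inl i)) (𝔗 (θ i) (y i)) t =
      ∑ j, P (Sum.inr j) (Ψ i j) t := by
    intro i
    have h : EqOn (w i) ⇑(volterraShift (θ i) (y i) + ∑ j, volterraShift (μ (i, j)) (Ψ i j))
        (Ici 0) := by
      intro s hs
      have := hrow i s hs
      simp only [ContinuousMap.add_apply, ContinuousMap.sum_apply, coe_volterraShift, Ψ,
        ContinuousMap.coe_mk]
      linarith
    rw [eqOn_𝔗l _ h ht, ← coe_volterraShift, ← coe_prod_volterraShift, ← coe_prod_volterraShift]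
    change P (Sum.inl i) _ t - P (Sum.inl i) _ t = _
    simp [map_add, map_sum, hP, ContinuousMap.sum_apply]
  have hB : ∀ j, 𝔗l (S (Sum.inr j)) (z j) t = -∑ i, P (Sum.inr j) (Ψ i j) t := by
    intro j
    have h : EqOn (z j) ⇑(-∑ i, Ψ i j) (Ici 0) := by
      intro s hs
      have := hcol j s hs
      simp only [ContinuousMap.neg_apply, ContinuousMap.sum_apply, Ψ, ContinuousMap.coe_mk]
      linarith
    rw [eqOn_𝔗l _ h ht, ← coe_prod_volterraShift]
    change P (Sum.inr j) _ t = _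
    simp [map_neg, map_sum, ContinuousMap.sum_apply]
  rw [← Finset.sum_sub_distrib, Finset.sum_congr rfl fun i _ => hA i,
    Finset.sum_congr rfl fun j _ => hB j, Finset.sum_neg_distrib, Finset.sum_comm, add_neg_cancel]
end

section
/- Let I and J be nonempty finite sets and let μ_j > 0 for each j ∈ J. There exists a constant m₂ > 0, depending only on I, J and (μ_j), such that whenever continuous functions y_i, w_i : [0,∞) → ℝ (i ∈ I), z_j : [0,∞) → ℝ (j ∈ J) and ψ_ij : [0,∞) → ℝ satisfy, for all t ≥ 0: ∑_{j∈J} (𝔗_{μ_j} ψ_ij)(t) = w_i(t) − y_i(t) for each i ∈ I; ∑_{i∈I} ψ_ij(t) = −z_j(t) for each j ∈ J; y_i(t) ≥ 0 and z_j(t) ≥ 0 for all i, j; and min(∑_{i∈I} y_i(t), ∑_{j∈J} z_j(t)) = 0; then for all t ≥ 0: ∑_{i∈I} |y_i(t)| + ∑_{j∈J} |z_j(t)| ≤ m₂ (1+t)^{m₂} · sup_{0≤s≤t} ∑_{i∈I} |w_i(s)|. -/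
open MeasureTheory Set

/-- If `∑ i, ψ i = -z` on `[0, ∞)`, then `∑ i, 𝔗_α (ψ i) = -𝔗_α z` there. -/
lemma sum_𝔗_eq_neg_𝔗 {I : Type*} [Fintype I] (α : ℝ) {ψ : I → ℝ → ℝ} {z : ℝ → ℝ}
    (hψ : ∀ i, Continuous (ψ i)) (h : ∀ t : ℝ, 0 ≤ t → ∑ i, ψ i t = - z t)
    {t : ℝ} (ht : 0 ≤ t) : ∑ i, 𝔗 α (ψ i) t = - 𝔗 α z t := by
  have hJ : ∑ i, 𝔍 (ψ i) t = - 𝔍 z t := by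
    unfold 𝔍
    rw [← intervalIntegral.integral_finsetSum
      (fun i _ => (hψ i).intervalIntegrable 0 t), ← intervalIntegral.integral_neg]
    refine intervalIntegral.integral_congr fun s hs => ?_
    rw [uIcc_of_le ht] at hs
    exact h s hs.1
  simp only [𝔗, Finset.sum_add_distrib, ← Finset.mul_sum, hJ, h t ht]
  ring

lemma 𝔍_nonneg {f : ℝ → ℝ} (hf : ∀ t : ℝ, 0 ≤ t → 0 ≤ f t) {t : ℝ} (ht : 0 ≤ t) :
    0 ≤ 𝔍 f t :=
  intervalIntegral.integral_nonneg ht fun s hs => hf s hs.1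

lemma 𝔍_le_mul_of_le {f : ℝ → ℝ} (hf : Continuous f) {t C : ℝ} (ht : 0 ≤ t)
    (hC : ∀ s ∈ Icc 0 t, f s ≤ C) : 𝔍 f t ≤ t * C := by
  have h := intervalIntegral.integral_mono_on (μ := volume) ht (hf.intervalIntegrable 0 t)
    (continuous_const.intervalIntegrable 0 t) hC
  simpa [𝔍] using h

/-- Proposition 2, station-dependent case `μ_ij = μ_j`:
there is `m₂ > 0`, depending only on the structural data, such that
`∑_i |y_i(t)| + ∑_j |z_j(t)| ≤ m₂ (1+t)^{m₂} sup_{0≤s≤t} ∑_i |w_i(s)|`. -/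
theorem y_z_polynomial_bound_station_dependent
    {I J : Type*} [Fintype I] [Fintype J] [Nonempty I] [Nonempty J]
    (μ : J → ℝ) (hμ : ∀ j, 0 < μ j) :
    ∃ m₂ : ℝ, 0 < m₂ ∧
      ∀ (y w : I → ℝ → ℝ) (z : J → ℝ → ℝ) (ψ : I → J → ℝ → ℝ),
        (∀ i, Continuous (y i)) → (∀ i, Continuous (w i)) →
        (∀ j, Continuous (z j)) → (∀ i j, Continuous (ψ i j)) →
        (∀ i, ∀ t : ℝ, 0 ≤ t → ∑ j, 𝔗 (μ j) (ψ i j) t = w i t - y i t) →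
        (∀ j, ∀ t : ℝ, 0 ≤ t → ∑ i, ψ i j t = - z j t) →
        (∀ i, ∀ t : ℝ, 0 ≤ t → 0 ≤ y i t) →
        (∀ j, ∀ t : ℝ, 0 ≤ t → 0 ≤ z j t) →
        (∀ t : ℝ, 0 ≤ t → min (∑ i, y i t) (∑ j, z j t) = 0) →
        ∀ t : ℝ, 0 ≤ t →
          (∑ i, |y i t|) + ∑ j, |z j t| ≤
            m₂ * (1 + t) ^ m₂ * sSup ((fun s => ∑ i, |w i s|) '' Icc 0 t) := by
  have hM : 0 ≤ ∑ j, μ j := Finset.sum_nonneg fun j _ => (hμ j).le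
  refine ⟨3 + ∑ j, μ j, by positivity, ?_⟩
  intro y w z ψ _ hw hz hψ hyw hψz hy0 hz0 hmin t ht
  set S := sSup ((fun s => ∑ i, |w i s|) '' Icc 0 t) with hS
  have hwS : ∀ s ∈ Icc 0 t, ∑ i, |w i s| ≤ S := fun s hs =>
    le_csSup (isCompact_Icc.bddAbove_image
      (continuous_finsetSum _ fun i _ => (hw i).abs).continuousOn) ⟨s, hs, rfl⟩
  have hS0 : 0 ≤ S := (Finset.sum_nonneg fun i _ => abs_nonneg (w i t)).trans
    (hwS t ⟨ht, le_rfl⟩)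
  have hbal : ∀ s : ℝ, 0 ≤ s →
      ∑ i, y i s = ∑ i, w i s + ∑ j, z j s + ∑ j, μ j * 𝔍 (z j) s := by
    intro s hs
    have h1 := Finset.sum_congr rfl fun i (_ : i ∈ Finset.univ) => hyw i s hs
    have h2 := Finset.sum_congr rfl fun j (_ : j ∈ Finset.univ) =>
      sum_𝔗_eq_neg_𝔗 (μ j) (fun i => hψ i j) (hψz j) hs
    rw [Finset.sum_comm, h2] at h1
    simp only [𝔗, Finset.sum_neg_distrib, Finset.sum_add_distrib, Finset.sum_sub_distrib] at h1
    linarith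
  have hZS : ∀ s ∈ Icc 0 t, ∑ j, z j s ≤ S := by
    intro s hs
    rcases min_choice (∑ i, y i s) (∑ j, z j s) with h | h <;> rw [hmin s hs.1] at h
    · have hA : 0 ≤ ∑ j, μ j * 𝔍 (z j) s := Finset.sum_nonneg fun j _ =>
        mul_nonneg (hμ j).le (𝔍_nonneg (hz0 j) hs.1)
      have hW := (neg_abs_le (∑ i, w i s))
      have hW' := Finset.abs_sum_le_sum_abs (fun i => w i s) Finset.univ
      linarith [hbal s hs.1, hwS s hs]
    · exact h ▸ hS0
  have hA : ∑ j, μ j * 𝔍 (z j) t ≤ (∑ j, μ j) * (t * S) := by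
    rw [Finset.sum_mul]
    refine Finset.sum_le_sum fun j _ => mul_le_mul_of_nonneg_left ?_ (hμ j).le
    refine 𝔍_le_mul_of_le (hz j) ht fun s hs => le_trans ?_ (hZS s hs)
    exact Finset.single_le_sum (f := fun j => z j s) (fun j _ => hz0 j s hs.1)
      (Finset.mem_univ j)
  have hpow : 1 + t ≤ (1 + t) ^ (3 + ∑ j, μ j) :=
    Real.self_le_rpow_of_one_le (by linarith) (by linarith)
  simp only [abs_of_nonneg (hy0 _ t ht), abs_of_nonneg (hz0 _ t ht)]
  have htt : t ∈ Icc 0 t := ⟨ht, le_rfl⟩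
  have hW : ∑ i, w i t ≤ S :=
    (Finset.sum_le_sum fun i _ => le_abs_self (w i t)).trans (hwS t htt)
  calc ∑ i, y i t + ∑ j, z j t
      ≤ 3 * S + (∑ j, μ j) * (t * S) := by linarith [hbal t ht, hZS t htt]
    _ ≤ (3 + ∑ j, μ j) * (1 + t) * S := by
        nlinarith [mul_nonneg hM hS0, mul_nonneg ht hS0]
    _ ≤ (3 + ∑ j, μ j) * (1 + t) ^ (3 + ∑ j, μ j) * S := by gcongr
end

section
/- Suppose the system (66)–(69) has the nonidling property: for every T > 0 and every family of measurable, locally bounded functions (ψ_ij, y_i, z_j, w_i) satisfying (66)–(69) on [0,T) in which each w_i is right-continuous, strictly increasing and satisfies w_i(0) > 0, one has z_j(t) = 0 for all j ∈ J and t ∈ [0,T). Then there exists a constant m₄ > 0, depending only on I, J, i₀, j₀, μ and θ, such that every family of measurable, locally bounded functions (ψ_ij, y_i, z_j, w_i) satisfying (66)–(69) on [0,∞) obeys, for all t ≥ 0: ∑_{i∈I} |x_i(t)| ≤ m₄ (1+t)^{m₄} (1 + sup_{0≤s≤t} ∑_{i∈I} |w_i(s)|), where x_i(t) = w_i(t)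 − ∑_{j∈J} μ_ij (𝔍ψ_ij)(t) − θ_i (𝔍y_i)(t). -/
open MeasureTheory Set

/-- The system (66)–(69) on the time set `S`, for the diameter-≤3 tree whose activity set
is `E = {(i,j₀) : i ∈ I} ∪ {(i₀,j) : j ∈ J}`. -/
def Sys {I J : Type*} [Fintype I] [Fintype J] (i₀ : I) (j₀ : J)
    (μ : I × J → ℝ) (θ : I → ℝ)
    (ψ : I → J → ℝ → ℝ) (y w : I → ℝ → ℝ) (z : J → ℝ → ℝ) (S : Set ℝ) : Prop :=
  (∀ i j, ¬(j = j₀ ∨ i = i₀) → ∀ t ∈ S, ψ i j t = 0) ∧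
  (∀ i, ∀ t ∈ S, ∑ j, (ψ i j t + μ (i, j) * 𝔍 (ψ i j) t)
      = w i t - y i t - θ i * 𝔍 (y i) t) ∧
  (∀ j, ∀ t ∈ S, ∑ i, ψ i j t = - z j t) ∧
  (∀ i, ∀ t ∈ S, 0 ≤ y i t) ∧
  (∀ j, ∀ t ∈ S, 0 ≤ z j t) ∧
  (∀ t ∈ S, min (∑ i, y i t) (∑ j, z j t) = 0)

/-- `f` is measurable and locally bounded on `[0, T)`. -/
def MeasLB (f : ℝ → ℝ) (T : ℝ) : Prop :=
  Measurable f ∧ ∀ b : ℝ, 0 ≤ b → b < T → ∃ C : ℝ, ∀ t ∈ Icc (0:ℝ) b, |f t| ≤ C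

/-- `f` is measurable and locally bounded on `[0, ∞)`. -/
def MeasLBInf (f : ℝ → ℝ) : Prop :=
  Measurable f ∧ ∀ b : ℝ, 0 ≤ b → ∃ C : ℝ, ∀ t ∈ Icc (0:ℝ) b, |f t| ≤ C

/-- The nonidling property of the system (66)–(69): whenever each `w_i` is right-continuous,
strictly increasing on `[0,T)` and `w_i(0) > 0`, the system incurs no idleness on `[0,T)`. -/
def Nonidling {I J : Type*} [Fintype I] [Fintype J] (i₀ : I) (j₀ : J)
    (μ : I × J → ℝ) (θ : I → ℝ) : Prop :=
  ∀ T : ℝ, 0 < T →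
    ∀ (ψ : I → J → ℝ → ℝ) (y w : I → ℝ → ℝ) (z : J → ℝ → ℝ),
      (∀ i j, MeasLB (ψ i j) T) → (∀ i, MeasLB (y i) T) → (∀ i, MeasLB (w i) T) →
      (∀ j, MeasLB (z j) T) →
      (∀ i, ∀ t ∈ Ico (0:ℝ) T, ContinuousWithinAt (w i) (Ici t) t) →
      (∀ i, StrictMonoOn (w i) (Ico (0:ℝ) T)) →
      (∀ i, 0 < w i 0) →
      Sys i₀ j₀ μ θ ψ y w z (Ico (0:ℝ) T) →
      ∀ j, ∀ t ∈ Ico (0:ℝ) T, z j t = 0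

/-- `f` is measurable, and bounded on `[0, T]`. -/
def BddMeas (f : ℝ → ℝ) (T : ℝ) : Prop :=
  Measurable f ∧ ∃ C : ℝ, ∀ s ∈ Icc (0:ℝ) T, |f s| ≤ C

namespace BddMeas

variable {f g : ℝ → ℝ} {T : ℝ}

theorem of_continuous (hf : Continuous f) : BddMeas f T := by
  refine ⟨hf.measurable, ?_⟩
  obtain ⟨C, hC⟩ := isCompact_Icc.exists_bound_of_continuousOn (s := Icc (0:ℝ) T) hf.continuousOn
  exact ⟨C, fun s hs => by simpa using hC s hs⟩

theorem of_abs_le (hf : Measurable f) (hg : BddMeas g T)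
    (h : ∀ s ∈ Icc (0:ℝ) T, |f s| ≤ |g s|) : BddMeas f T := by
  obtain ⟨C, hC⟩ := hg.2
  exact ⟨hf, C, fun s hs => (h s hs).trans (hC s hs)⟩

theorem add (hf : BddMeas f T) (hg : BddMeas g T) : BddMeas (fun s => f s + g s) T := by
  obtain ⟨C, hC⟩ := hf.2
  obtain ⟨D, hD⟩ := hg.2
  exact ⟨hf.1.add hg.1, C + D, fun s hs => (abs_add_le _ _).trans (add_le_add (hC s hs) (hD s hs))⟩

theorem const_mul (c : ℝ) (hf : BddMeas f T) : BddMeas (fun s => c * f s) T := by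
  obtain ⟨C, hC⟩ := hf.2
  refine ⟨hf.1.const_mul c, |c| * C, fun s hs => ?_⟩
  rw [abs_mul]
  exact mul_le_mul_of_nonneg_left (hC s hs) (abs_nonneg c)

theorem sub (hf : BddMeas f T) (hg : BddMeas g T) : BddMeas (fun s => f s - g s) T := by
  simpa [sub_eq_add_neg] using hf.add (hg.const_mul (-1))

theorem sum {ι : Type*} (F : Finset ι) {f : ι → ℝ → ℝ} (hf : ∀ i, BddMeas (f i) T) :
    BddMeas (fun s => ∑ i ∈ F, f i s) T := by
  classical
  induction F using Finset.induction_on with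
  | empty => simpa using of_continuous (f := fun _ => (0:ℝ)) continuous_const
  | insert a F ha ih => simpa [Finset.sum_insert ha] using (hf a).add ih

theorem intervalIntegrable (hf : BddMeas f T) {a b : ℝ} (ha : a ∈ Icc 0 T) (hb : b ∈ Icc 0 T) :
    IntervalIntegrable f volume a b := by
  obtain ⟨C, hC⟩ := hf.2
  rw [intervalIntegrable_iff]
  refine Measure.integrableOn_of_bounded (M := C) (by simp) hf.1.aestronglyMeasurable ?_
  filter_upwards [ae_restrict_mem measurableSet_uIoc] with s hs
  exact hC s ⟨(le_min ha.1 hb.1).trans hs.1.le, hs.2.trans (max_le ha.2 hb.2)⟩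

theorem measLB (hf : BddMeas f T) : MeasLB f T := by
  obtain ⟨C, hC⟩ := hf.2
  exact ⟨hf.1, fun b _ hbT => ⟨C, fun s hs => hC s ⟨hs.1, hs.2.trans hbT.le⟩⟩⟩

theorem integral_eq_sub (hf : BddMeas f T) {a b : ℝ} (ha : a ∈ Icc 0 T) (hb : b ∈ Icc 0 T) :
    ∫ s in a..b, f s = 𝔍 f b - 𝔍 f a := by
  have h0 : (0:ℝ) ∈ Icc 0 T := ⟨le_rfl, ha.1.trans ha.2⟩
  exact (intervalIntegral.integral_interval_sub_left (hf.intervalIntegrable h0 hb)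
    (hf.intervalIntegrable h0 ha)).symm

theorem continuousOn_integral (hf : BddMeas f T) : ContinuousOn (𝔍 f) (Icc 0 T) := by
  rcases lt_or_ge T 0 with hT | hT
  · simp [Icc_eq_empty_of_lt hT]
  · have := intervalIntegral.continuousOn_primitive_interval (f := f) (a := 0) (b := T)
      (μ := volume) ((intervalIntegrable_iff_integrableOn_Icc_of_le hT).1
        (hf.intervalIntegrable ⟨le_rfl, hT⟩ ⟨hT, le_rfl⟩) |>.mono_set (by rw [uIcc_of_le hT]))
    rwa [uIcc_of_le hT] at this

theorem integral_add (hf : BddMeas f T) (hg : BddMeas g T) {s : ℝ} (hs : s ∈ Icc 0 T) :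
    𝔍 (fun u => f u + g u) s = 𝔍 f s + 𝔍 g s :=
  have h0 : (0:ℝ) ∈ Icc 0 T := ⟨le_rfl, hs.1.trans hs.2⟩
  intervalIntegral.integral_add (hf.intervalIntegrable h0 hs) (hg.intervalIntegrable h0 hs)

theorem integral_sub (hf : BddMeas f T) (hg : BddMeas g T) {s : ℝ} (hs : s ∈ Icc 0 T) :
    𝔍 (fun u => f u - g u) s = 𝔍 f s - 𝔍 g s :=
  have h0 : (0:ℝ) ∈ Icc 0 T := ⟨le_rfl, hs.1.trans hs.2⟩
  intervalIntegral.integral_sub (hf.intervalIntegrable h0 hs) (hg.intervalIntegrable h0 hs)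

theorem integral_sum {ι : Type*} (F : Finset ι) {f : ι → ℝ → ℝ} (hf : ∀ i, BddMeas (f i) T)
    {s : ℝ} (hs : s ∈ Icc 0 T) :
    𝔍 (fun u => ∑ i ∈ F, f i u) s = ∑ i ∈ F, 𝔍 (f i) s :=
  have h0 : (0:ℝ) ∈ Icc 0 T := ⟨le_rfl, hs.1.trans hs.2⟩
  intervalIntegral.integral_finsetSum fun i _ => (hf i).intervalIntegrable h0 hs

theorem le_integral (hf : BddMeas f T) {a b c : ℝ} (ha : a ∈ Icc 0 T) (hb : b ∈ Icc 0 T)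
    (hab : a ≤ b) (h : ∀ s ∈ Ioo a b, c ≤ f s) : c * (b - a) ≤ 𝔍 f b - 𝔍 f a := by
  rw [← hf.integral_eq_sub ha hb]
  have := intervalIntegral.integral_mono_on_of_le_Ioo (μ := volume) hab
    (intervalIntegrable_const (c := c)) (hf.intervalIntegrable ha hb) h
  simpa [mul_comm] using this

theorem integral_le (hf : BddMeas f T) {a b c : ℝ} (ha : a ∈ Icc 0 T) (hb : b ∈ Icc 0 T)
    (hab : a ≤ b) (h : ∀ s ∈ Ioo a b, f s ≤ c) : 𝔍 f b - 𝔍 f a ≤ c * (b - a) := by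
  rw [← hf.integral_eq_sub ha hb]
  have := intervalIntegral.integral_mono_on_of_le_Ioo (μ := volume) hab
    (hf.intervalIntegrable ha hb) (intervalIntegrable_const (c := c)) h
  simpa [mul_comm] using this

end BddMeas

theorem MeasLBInf.bddMeas {f : ℝ → ℝ} (hf : MeasLBInf f) {T : ℝ} (hT : 0 ≤ T) : BddMeas f T :=
  ⟨hf.1, hf.2 T hT⟩

theorem integral_zero_left (f : ℝ → ℝ) : 𝔍 f 0 = 0 := intervalIntegral.integral_same

theorem integral_const_mul_fun (c : ℝ) (f : ℝ → ℝ) (s : ℝ) :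
    𝔍 (fun u => c * f u) s = c * 𝔍 f s :=
  intervalIntegral.integral_const_mul c f

/-- Two functions that agree on `[0, s)` have the same integral over `[0, s]`. -/
theorem integral_congr_Ico {f g : ℝ → ℝ} {s : ℝ} (hs : 0 ≤ s) (h : ∀ u ∈ Ico 0 s, f u = g u) :
    𝔍 f s = 𝔍 g s := by
  refine intervalIntegral.integral_congr_ae_restrict ?_
  rw [uIoc_of_le hs, ← restrict_Ioo_eq_restrict_Ioc]
  filter_upwards [ae_restrict_mem measurableSet_Ioo] with u hu
  exact h u ⟨hu.1.le, hu.2⟩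

/-- The function equal to `f` before time `T` and to `g` from time `T` on. -/
noncomputable def glue (T : ℝ) (f g : ℝ → ℝ) (s : ℝ) : ℝ := if s < T then f s else g s

theorem glue_of_lt {T s : ℝ} (f g : ℝ → ℝ) (h : s < T) : glue T f g s = f s := if_pos h

theorem glue_of_le {T s : ℝ} (f g : ℝ → ℝ) (h : T ≤ s) : glue T f g s = g s := if_neg h.not_gt

theorem BddMeas.glue {f g : ℝ → ℝ} {T : ℝ} (hf : BddMeas f T) (hg : Continuous g) (T' : ℝ) :
    BddMeas (glue T f g) T' := by
  obtain ⟨C, hC⟩ := hf.2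
  obtain ⟨D, hD⟩ := (of_continuous hg : BddMeas g T').2
  refine ⟨Measurable.ite measurableSet_Iio hf.1 hg.measurable, max C D, fun s hs => ?_⟩
  rcases lt_or_ge s T with h | h
  · rw [glue_of_lt f g h]
    exact (hC s ⟨hs.1, h.le⟩).trans (le_max_left _ _)
  · rw [glue_of_le f g h]
    exact (hD s hs).trans (le_max_right _ _)

theorem integral_glue_of_le {f g : ℝ → ℝ} {T s : ℝ} (hs : 0 ≤ s) (h : s ≤ T) :
    𝔍 (glue T f g) s = 𝔍 f s :=
  integral_congr_Ico hs fun _ hu => glue_of_lt f g (hu.2.trans_le h)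

theorem integral_glue_of_ge {f g : ℝ → ℝ} {T s : ℝ} (hT : 0 ≤ T) (hf : BddMeas f T)
    (hg : Continuous g) (h : T ≤ s) :
    𝔍 (glue T f g) s = 𝔍 f T + ∫ u in T..s, g u := by
  have hb := hf.glue hg s
  have h1 := hb.integral_eq_sub (a := T) (b := s) ⟨hT, h⟩ ⟨hT.trans h, le_rfl⟩
  have h2 : ∫ u in T..s, glue T f g u = ∫ u in T..s, g u := by
    refine intervalIntegral.integral_congr fun u hu => glue_of_le f g ?_
    rw [uIcc_of_le h] at hu
    exact hu.1
  rw [integral_glue_of_le hT le_rfl, h2] at h1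
  linarith

/-- A continuous function that is nonnegative at `0` and negative somewhere later is negative at
some time before which it has only dropped below `0` by an arbitrarily small amount. -/
theorem exists_neg_of_slight_drop {X : ℝ → ℝ} (hX : Continuous X) (h0 : 0 ≤ X 0) {τ η : ℝ}
    (hτ : 0 ≤ τ) (hXτ : X τ < 0) (hη : 0 < η) :
    ∃ h : ℝ, 0 < h ∧ X h < 0 ∧ ∀ s ∈ Ico 0 h, -η ≤ X s := by
  set c := min η (-X τ) with hc
  have hc0 : 0 < c := lt_min hη (by linarith)
  have hcomp : IsCompact (Icc 0 τ ∩ {s | X s ≤ -c}) :=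
    isCompact_Icc.inter_right (isClosed_le hX continuous_const)
  obtain ⟨h, hh, hmin⟩ := hcomp.exists_isLeast
    ⟨τ, ⟨hτ, le_rfl⟩, by have := min_le_right η (-X τ); exact (by linarith : X τ ≤ -c)⟩
  have hXh : X h ≤ -c := hh.2
  have hpos : 0 < h := by
    rcases hh.1.1.eq_or_lt with h' | h'
    · rw [← h'] at hXh; linarith
    · exact h'
  refine ⟨h, hpos, by linarith, fun s hs => ?_⟩
  by_contra! hlt
  have : h ≤ s := hmin ⟨⟨hs.1, hs.2.le.trans hh.1.2⟩, by
    have := min_le_left η (-X τ); exact (by linarith : X s ≤ -c)⟩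
  exact absurd hs.2 this.not_gt

/-- If `Q = 𝔍 q` satisfies `Q' ≤ C - m Q`, then `Q ≤ C / m`. -/
theorem integral_le_div_of_le_sub_mul {q : ℝ → ℝ} {T C m : ℝ} (hT : 0 ≤ T) (hC : 0 ≤ C)
    (hm : 0 < m) (hq : BddMeas q T) (h : ∀ s ∈ Ico 0 T, q s ≤ C - m * 𝔍 q s) :
    𝔍 q T ≤ C / m := by
  by_contra! hlt
  have hcomp : IsCompact (Icc 0 T ∩ 𝔍 q ⁻¹' Iic (C / m)) :=
    isCompact_Icc.of_isClosed_subset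
      (hq.continuousOn_integral.preimage_isClosed_of_isClosed isClosed_Icc isClosed_Iic)
      inter_subset_left
  obtain ⟨a, ha, hmax⟩ := hcomp.exists_isGreatest
    ⟨0, ⟨le_rfl, hT⟩, by simp only [mem_preimage, integral_zero_left, mem_Iic]; positivity⟩
  have haQ : 𝔍 q a ≤ C / m := ha.2
  have := hq.integral_le (c := 0) ha.1 ⟨hT, le_rfl⟩ ha.1.2 fun s hs => by
    have hs' : s ∈ Ico 0 T := ⟨ha.1.1.trans hs.1.le, hs.2⟩
    have hQs : C / m < 𝔍 q s := by
      by_contra! hle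
      exact absurd hs.1 (not_lt.2 (hmax ⟨⟨hs'.1, hs'.2.le⟩, hle⟩))
    rw [div_lt_iff₀ hm] at hQs
    have := h s hs'
    linarith
  linarith

/-- The system with a single pool of servers: class `i` has service rate `m i` and abandonment
rate `θ i`. -/
def SinglePool {I : Type*} [Fintype I] (m θ : I → ℝ) (q y w : I → ℝ → ℝ) (ζ : ℝ → ℝ)
    (S : Set ℝ) : Prop :=
  (∀ i, ∀ t ∈ S, q i t + m i * 𝔍 (q i) t = w i t - y i t - θ i * 𝔍 (y i) t) ∧
  (∀ t ∈ S, ∑ i, q i t = - ζ t) ∧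
  (∀ i, ∀ t ∈ S, 0 ≤ y i t) ∧
  (∀ t ∈ S, 0 ≤ ζ t) ∧
  (∀ t ∈ S, min (∑ i, y i t) (ζ t) = 0)

/-- The nonidling property of the single-pool system. -/
def SinglePoolNonidling {I : Type*} [Fintype I] (m θ : I → ℝ) : Prop :=
  ∀ T : ℝ, 0 < T → ∀ (q y w : I → ℝ → ℝ) (ζ : ℝ → ℝ),
    (∀ i, MeasLB (q i) T) → (∀ i, MeasLB (y i) T) → (∀ i, MeasLB (w i) T) → MeasLB ζ T →
    (∀ i, ∀ t ∈ Ico (0:ℝ) T, ContinuousWithinAt (w i) (Ici t) t) →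
    (∀ i, StrictMonoOn (w i) (Ico (0:ℝ) T)) →
    (∀ i, 0 < w i 0) →
    SinglePool m θ q y w ζ (Ico (0:ℝ) T) →
    ∀ t ∈ Ico (0:ℝ) T, ζ t = 0

theorem integral_zero_fun (s : ℝ) : 𝔍 (fun _ => (0:ℝ)) s = 0 := by simp [𝔍]

theorem measLB_zero (T : ℝ) : MeasLB (fun _ => (0:ℝ)) T :=
  (BddMeas.of_continuous continuous_const).measLB

/-- Using only the station `j₀` shows that nonidling passes to the single-pool system. -/
theorem Nonidling.singlePool {I J : Type*} [Fintype I] [Fintype J] {i₀ : I} {j₀ : J}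
    {μ : I × J → ℝ} {θ : I → ℝ} (hni : Nonidling i₀ j₀ μ θ) :
    SinglePoolNonidling (fun i => μ (i, j₀)) θ := by
  classical
  intro T hT q y w ζ hq hy hw hζ hc hm h0 ⟨e1, e2, e3, e4, e5⟩ t ht
  have := hni T hT (fun i j => if j = j₀ then q i else fun _ => 0) y w
    (fun j => if j = j₀ then ζ else fun _ => 0)
    (fun i j => by split_ifs; exacts [hq i, measLB_zero T]) hy hw
    (fun j => by split_ifs; exacts [hζ, measLB_zero T]) hc hm h0
    ⟨fun i j hij s hs => by
        have hj : j ≠ j₀ := fun h => hij (Or.inl h)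
        simp [hj],
      fun i s hs => by
        rw [← e1 i s hs, Finset.sum_eq_single j₀]
        · simp
        · intro j _ hj
          simp [if_neg hj, integral_zero_fun]
        · simp,
      fun j s hs => by
        by_cases hj : j = j₀
        · simpa [hj] using e2 s hs
        · simp [hj],
      e3,
      fun j s hs => by
        dsimp only
        split_ifs
        exacts [e4 s hs, le_rfl],
      fun s hs => by
        have hsum : ∑ j, (if j = j₀ then ζ else fun _ => 0) s = ζ s := by
          rw [Finset.sum_eq_single j₀]
          · simp
          · intro j _ hj
            simp [hj]
          · simp
        rw [hsum]
        exact e5 s hs⟩ j₀ t ht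
  simpa using this

/-- If the station has not idled before time `T`, the total content at time `T` is nonnegative. -/
theorem SinglePool.sum_content_nonneg {I : Type*} [Fintype I] {m θ : I → ℝ} {q y w : I → ℝ → ℝ}
    {T : ℝ} (hT : 0 < T) (hq : ∀ i, BddMeas (q i) T) (hy : ∀ i, BddMeas (y i) T)
    (hw : ∀ i, Continuous (w i)) (h : SinglePool m θ q y w (fun _ => 0) (Ico 0 T)) :
    0 ≤ ∑ i, (w i T - m i * 𝔍 (q i) T - θ i * 𝔍 (y i) T) := by
  have hcont : ContinuousOn (fun s => ∑ i, (w i s - m i * 𝔍 (q i) s - θ i * 𝔍 (y i) s))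
      (Icc 0 T) := by
    refine continuousOn_finsetSum _ fun i _ => ?_
    exact ((hw i).continuousOn.sub (continuousOn_const.mul (hq i).continuousOn_integral)).sub
      (continuousOn_const.mul (hy i).continuousOn_integral)
  have hclos : T ∈ closure (Ico 0 T) := by
    rw [closure_Ico hT.ne]
    exact ⟨hT.le, le_rfl⟩
  have := ContinuousWithinAt.closure_le (f := fun _ => (0:ℝ)) hclos continuousWithinAt_const
    ((hcont T ⟨hT.le, le_rfl⟩).mono Ico_subset_Icc_self) fun s hs => by
      have hx : ∀ i, w i s - m i * 𝔍 (q i) s - θ i * 𝔍 (y i) s = q i s + y i s := fun i => by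
        have := h.1 i s hs
        linarith
      have h2 := h.2.1 s hs
      simp only [hx, Finset.sum_add_distrib]
      have := Finset.sum_nonneg fun i (_ : i ∈ Finset.univ) => h.2.2.1 i s hs
      linarith
  exact this

theorem integral_exp_decay (m x ε T s : ℝ) (hm : m ≠ 0) :
    ∫ u in T..s, (x * Real.exp (-(m * (u - T))) + ε)
      = x * (1 - Real.exp (-(m * (s - T)))) / m + ε * (s - T) := by
  rw [intervalIntegral.integral_eq_sub_of_hasDerivAt
    (f := fun u => x * (1 - Real.exp (-(m * (u - T)))) / m + ε * (u - T))]
  · simp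
  · intro u _
    have h1 : HasDerivAt (fun u => u - T) 1 u := (hasDerivAt_id u).sub_const T
    have h2 := ((((h1.const_mul m).neg.exp).const_sub 1).const_mul x).div_const m
    refine (h2.add (h1.const_mul ε)).congr_deriv ?_
    simp only [Pi.neg_apply]
    field_simp
  · exact (by fun_prop :
      Continuous fun u => x * Real.exp (-(m * (u - T))) + ε).intervalIntegrable _ _

theorem tendsto_exp_decay {m : ℝ} (hm : 0 < m) :
    Filter.Tendsto (fun τ => Real.exp (-(m * τ))) Filter.atTop (nhds 0) :=
  Real.tendsto_exp_neg_atTop_nhds_zero.comp (Filter.tendsto_id.const_mul_atTop hm)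

/-- The function by which the total content is continued past time `T`. -/
noncomputable def continuedTotal {I : Type*} [Fintype I] [DecidableEq I] (i₀ : I) (m x : I → ℝ)
    (ε τ : ℝ) : ℝ :=
  x i₀ + ε * τ + ∑ k ∈ Finset.univ.erase i₀, ((x k * Real.exp (-(m k * τ)) + ε)
    + m i₀ * (x k * (1 - Real.exp (-(m k * τ))) / m k + ε * τ))

theorem exists_continuedTotal_neg {I : Type*} [Fintype I] [DecidableEq I] (i₀ : I) {m x : I → ℝ}
    (hm : ∀ i, 0 < m i) (hx : ∑ i, x i / m i < 0) :
    ∃ ε τ : ℝ, 0 < ε ∧ 0 < τ ∧ continuedTotal i₀ m x ε τ < 0 := by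
  have hlim : Filter.Tendsto (fun τ => continuedTotal i₀ m x 0 τ) Filter.atTop
      (nhds (m i₀ * ∑ i, x i / m i)) := by
    have : m i₀ * ∑ i, x i / m i = x i₀ + ∑ k ∈ Finset.univ.erase i₀,
        (x k * 0 + m i₀ * (x k * (1 - 0) / m k)) := by
      rw [← Finset.add_sum_erase _ _ (Finset.mem_univ i₀), mul_add, Finset.mul_sum,
        mul_div_cancel₀ _ (hm i₀).ne']
      simp
    rw [this]
    simp only [continuedTotal, zero_mul, add_zero]
    refine tendsto_const_nhds.add (tendsto_finsetSum _ fun k _ => ?_)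
    have hk := tendsto_exp_decay (hm k)
    exact (hk.const_mul _).add ((((hk.const_sub 1).const_mul _).div_const _).const_mul _)
  have hneg : m i₀ * ∑ i, x i / m i < 0 := mul_neg_of_pos_of_neg (hm i₀) hx
  obtain ⟨τ, hτ0, hτ⟩ := ((hlim.eventually_lt_const hneg).and
    (Filter.eventually_gt_atTop 0)).exists
  set c := τ + ∑ k ∈ Finset.univ.erase i₀, (1 + m i₀ * τ) with hc
  have hc0 : 0 < c := add_pos_of_pos_of_nonneg hτ (Finset.sum_nonneg fun k _ =>
    add_nonneg zero_le_one (mul_nonneg (hm i₀).le hτ.le))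
  have hlin : ∀ ε, continuedTotal i₀ m x ε τ = continuedTotal i₀ m x 0 τ + ε * c := fun ε => by
    simp only [continuedTotal, hc, mul_add, Finset.mul_sum, zero_mul, add_zero, add_assoc]
    rw [add_left_comm (∑ _ ∈ _, _), ← Finset.sum_add_distrib]
    congr 2
    exact Finset.sum_congr rfl fun k _ => by ring
  refine ⟨-continuedTotal i₀ m x 0 τ / (2 * c), τ, by apply div_pos <;> linarith, hτ, ?_⟩
  rw [hlin]
  have : -continuedTotal i₀ m x 0 τ / (2 * c) * c = -continuedTotal i₀ m x 0 τ / 2 := by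
    field_simp
  linarith

theorem continuous_continuedTotal {I : Type*} [Fintype I] [DecidableEq I] (i₀ : I) (m x : I → ℝ)
    (ε : ℝ) : Continuous (continuedTotal i₀ m x ε) := by
  unfold continuedTotal
  fun_prop

/-- In a nonidling single-pool system that has not idled before time `T`, the total remaining
service requirement at time `T` is nonnegative. -/
theorem SinglePoolNonidling.workload_nonneg {I : Type*} [Fintype I] (i₀ : I) {m θ : I → ℝ}
    (hm : ∀ i, 0 < m i) (hθ : ∀ i, 0 ≤ θ i) (hni : SinglePoolNonidling m θ)
    {q y w : I → ℝ → ℝ} {T : ℝ} (hT : 0 < T) (hq : ∀ i, BddMeas (q i) T)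
    (hy : ∀ i, BddMeas (y i) T) (hw : ∀ i, Continuous (w i))
    (hmono : ∀ i, StrictMonoOn (w i) (Icc 0 T)) (hw0 : ∀ i, 0 < w i 0)
    (h : SinglePool m θ q y w (fun _ => 0) (Ico 0 T)) :
    0 ≤ ∑ i, (w i T - m i * 𝔍 (q i) T - θ i * 𝔍 (y i) T) / m i := by
  classical
  by_contra! hneg
  set x : I → ℝ := fun i => w i T - m i * 𝔍 (q i) T - θ i * 𝔍 (y i) T with hx
  obtain ⟨ε, τ, hε, hτ, hXτ⟩ := exists_continuedTotal_neg i₀ hm hneg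
  set X := continuedTotal i₀ m x ε with hXdef
  have hXc : Continuous X := continuous_continuedTotal i₀ m x ε
  have hX0 : 0 ≤ X 0 := by
    have h1 := SinglePool.sum_content_nonneg hT hq hy hw h
    rw [← Finset.add_sum_erase _ _ (Finset.mem_univ i₀)] at h1
    have h2 : X 0 = x i₀ + ∑ k ∈ Finset.univ.erase i₀, x k
        + ∑ k ∈ Finset.univ.erase i₀, ε := by
      simp only [hXdef, continuedTotal, Finset.sum_add_distrib, mul_zero, neg_zero, Real.exp_zero,
        mul_one, sub_self, zero_div, add_zero]
      ring
    have h3 : 0 ≤ ∑ k ∈ Finset.univ.erase i₀, ε := Finset.sum_nonneg fun _ _ => hε.le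
    rw [h2]
    exact add_nonneg h1 h3
  have hm₀ := hm i₀
  obtain ⟨b, hb, hXb, hdrop⟩ := exists_neg_of_slight_drop hXc hX0 hτ.le hXτ
    (η := ε / (2 * m i₀)) (by positivity)
  set p : I → ℝ → ℝ := fun k s => x k * Real.exp (-(m k * (s - T))) + ε with hp
  set yc : ℝ → ℝ := fun s => max (X (s - T)) 0 with hyc
  set zc : ℝ → ℝ := fun s => max (-X (s - T)) 0 with hzc
  have hpc : ∀ k, Continuous (p k) := fun k => by rw [hp]; fun_prop
  have hycc : Continuous yc := by rw [hyc]; fun_prop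
  have hzcc : Continuous zc := by rw [hzc]; fun_prop
  have hyz : ∀ s, yc s - zc s = X (s - T) := fun s => by
    simp only [hyc, hzc]
    rcases le_total 0 (X (s - T)) with h | h
    · rw [max_eq_left h, max_eq_right (by linarith)]; ring
    · rw [max_eq_right h, max_eq_left (by linarith)]; ring
  set qn : I → ℝ → ℝ := fun i s =>
    if i = i₀ then -zc s - ∑ k ∈ Finset.univ.erase i₀, p k s else p i s with hqn
  set yn : I → ℝ → ℝ := fun i s => if i = i₀ then yc s else 0 with hyn
  set wn : I → ℝ → ℝ := fun i s =>
    if i = i₀ then w i₀ T + ε * (s - T) - m i₀ * (∫ u in T..s, zc u) + θ i₀ * ∫ u in T..s, yc u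
    else w i T + ε + m i * ε * (s - T) with hwn
  have hqnc : ∀ i, Continuous (qn i) := fun i => by
    by_cases hi : i = i₀
    · simp only [hqn, hi, if_true]
      exact hzcc.neg.sub (continuous_finsetSum _ fun k _ => hpc k)
    · simp only [hqn, hi, if_false]
      exact hpc i
  have hync : ∀ i, Continuous (yn i) := fun i => by
    by_cases hi : i = i₀
    · simpa only [hyn, hi, if_true] using hycc
    · simpa only [hyn, hi, if_false] using continuous_const
  have hprim : ∀ {f : ℝ → ℝ}, Continuous f → Continuous fun s => ∫ u in T..s, f u := fun hf =>
    intervalIntegral.continuous_primitive (fun _ _ => hf.intervalIntegrable _ _) T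
  have hwnc : ∀ i, Continuous (wn i) := fun i => by
    by_cases hi : i = i₀
    · simp only [hwn, hi, if_true]
      have h1 := hprim hzcc
      have h2 := hprim hycc
      fun_prop
    · simp only [hwn, hi, if_false]
      fun_prop
  have hwnT : ∀ i, w i T ≤ wn i T := fun i => by
    by_cases hi : i = i₀
    · simp [hwn, hi]
    · simp [hwn, hi, hε.le]
  have hwnmono : ∀ i, StrictMonoOn (wn i) (Ico T (T + b)) := fun i s hs u hu hsu => by
    by_cases hi : i = i₀
    · simp only [hwn, hi, if_true]
      have hz : (∫ r in T..u, zc r) - ∫ r in T..s, zc r = ∫ r in s..u, zc r :=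
        intervalIntegral.integral_interval_sub_left (hzcc.intervalIntegrable _ _)
          (hzcc.intervalIntegrable _ _)
      have hy' : (∫ r in T..u, yc r) - ∫ r in T..s, yc r = ∫ r in s..u, yc r :=
        intervalIntegral.integral_interval_sub_left (hycc.intervalIntegrable _ _)
          (hycc.intervalIntegrable _ _)
      have hy0 : 0 ≤ ∫ r in s..u, yc r :=
        intervalIntegral.integral_nonneg hsu.le fun _ _ => le_max_right _ _
      have hz0 : ∫ r in s..u, zc r ≤ (u - s) * (ε / (2 * m i₀)) := by
        have := intervalIntegral.integral_mono_on (μ := volume) hsu.le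
          (hzcc.intervalIntegrable _ _)
          (intervalIntegrable_const (c := ε / (2 * m i₀))) fun r hr => by
            refine max_le ?_ (by positivity)
            have := hdrop (r - T) ⟨by linarith [hs.1, hr.1], by linarith [hu.2, hr.2]⟩
            linarith
        rwa [intervalIntegral.integral_const, smul_eq_mul] at this
      have h1 : m i₀ * ∫ r in s..u, zc r ≤ (u - s) * ε / 2 := by
        calc m i₀ * ∫ r in s..u, zc r ≤ m i₀ * ((u - s) * (ε / (2 * m i₀))) :=
              mul_le_mul_of_nonneg_left hz0 hm₀.le
          _ = (u - s) * ε / 2 := by field_simp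
      have h2 := mul_nonneg (hθ i₀) hy0
      rw [← hz] at h1
      rw [← hy'] at h2
      have h3 : 0 < (u - s) * ε := mul_pos (by linarith) hε
      linarith
    · simp only [hwn, hi, if_false]
      have : m i * ε * (s - T) < m i * ε * (u - T) :=
        mul_lt_mul_of_pos_left (by linarith) (mul_pos (hm i) hε)
      linarith
  have hQ : ∀ i s, T ≤ s → 𝔍 (glue T (q i) (qn i)) s = 𝔍 (q i) T + ∫ u in T..s, qn i u :=
    fun i s hs => integral_glue_of_ge hT.le (hq i) (hqnc i) hs
  have hY : ∀ i s, T ≤ s → 𝔍 (glue T (y i) (yn i)) s = 𝔍 (y i) T + ∫ u in T..s, yn i u :=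
    fun i s hs => integral_glue_of_ge hT.le (hy i) (hync i) hs
  have hzero : BddMeas (fun _ => (0:ℝ)) T := .of_continuous continuous_const
  have hidle := hni (T + b) (by linarith) (fun i => glue T (q i) (qn i))
    (fun i => glue T (y i) (yn i)) (fun i => glue T (w i) (wn i)) (glue T (fun _ => 0) zc)
    (fun i => ((hq i).glue (hqnc i) _).measLB) (fun i => ((hy i).glue (hync i) _).measLB)
    (fun i => ((BddMeas.of_continuous (hw i)).glue (hwnc i) _).measLB)
    (hzero.glue hzcc _).measLB
    (fun i t _ => by
      rcases lt_or_ge t T with htT | htT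
      · refine ((hw i).continuousAt.congr ?_).continuousWithinAt
        filter_upwards [Iio_mem_nhds htT] with s hs
        exact (glue_of_lt _ _ hs).symm
      · exact (hwnc i).continuousWithinAt.congr
          (fun s hs => glue_of_le _ _ (htT.trans hs)) (glue_of_le _ _ htT))
    (fun i s hs u hu hsu => by
      rcases lt_or_ge u T with huT | huT
      · rw [glue_of_lt _ _ huT, glue_of_lt _ _ (hsu.trans huT)]
        exact hmono i ⟨hs.1, (hsu.trans huT).le⟩ ⟨hu.1, huT.le⟩ hsu
      · rw [glue_of_le _ _ huT]
        have hTu : wn i T ≤ wn i u :=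
          (hwnmono i).monotoneOn ⟨le_rfl, by linarith⟩ ⟨huT, hu.2⟩ huT
        rcases lt_or_ge s T with hsT | hsT
        · rw [glue_of_lt _ _ hsT]
          exact (hmono i ⟨hs.1, hsT.le⟩ ⟨hT.le, le_rfl⟩ hsT).trans_le ((hwnT i).trans hTu)
        · rw [glue_of_le _ _ hsT]
          exact hwnmono i ⟨hsT, hs.2⟩ ⟨huT, hu.2⟩ hsu)
    (fun i => by rw [glue_of_lt _ _ hT]; exact hw0 i)
    ⟨fun i s hs => by
      dsimp only
      rcases lt_or_ge s T with hsT | hsT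
      · rw [glue_of_lt _ _ hsT, glue_of_lt _ _ hsT, glue_of_lt _ _ hsT,
          integral_glue_of_le hs.1 hsT.le, integral_glue_of_le hs.1 hsT.le]
        exact h.1 i s ⟨hs.1, hsT⟩
      · rw [glue_of_le _ _ hsT, glue_of_le _ _ hsT, glue_of_le _ _ hsT, hQ i s hsT, hY i s hsT]
        by_cases hi : i = i₀
        · subst hi
          simp only [hqn, hyn, hwn, if_true]
          rw [intervalIntegral.integral_sub (hzcc.fun_neg.intervalIntegrable _ _)
            ((continuous_finsetSum _ fun k _ => hpc k).intervalIntegrable _ _),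
            intervalIntegral.integral_neg,
            intervalIntegral.integral_finsetSum fun k _ => (hpc k).intervalIntegrable _ _]
          simp only [hp, integral_exp_decay _ _ _ _ _ (hm _).ne']
          have h1 := hyz s
          rw [hXdef, continuedTotal] at h1
          rw [Finset.sum_add_distrib, ← Finset.mul_sum] at h1
          have h2 : x i = w i T - m i * 𝔍 (q i) T - θ i * 𝔍 (y i) T := rfl
          linarith
        · simp only [hqn, hyn, hwn, if_neg hi, hp, integral_exp_decay _ _ _ _ _ (hm i).ne',
            intervalIntegral.integral_zero]
          have h2 : x i = w i T - m i * 𝔍 (q i) T - θ i * 𝔍 (y i) T := rfl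
          have hmi := (hm i).ne'
          field_simp
          linarith,
    fun s hs => by
      rcases lt_or_ge s T with hsT | hsT
      · simp only [glue_of_lt _ _ hsT]
        exact h.2.1 s ⟨hs.1, hsT⟩
      · simp only [glue_of_le _ _ hsT]
        rw [← Finset.add_sum_erase _ _ (Finset.mem_univ i₀)]
        have : ∑ k ∈ Finset.univ.erase i₀, qn k s = ∑ k ∈ Finset.univ.erase i₀, p k s :=
          Finset.sum_congr rfl fun k hk => by simp [hqn, Finset.ne_of_mem_erase hk]
        rw [this]
        simp [hqn],
    fun i s hs => by
      dsimp only
      rcases lt_or_ge s T with hsT | hsT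
      · rw [glue_of_lt _ _ hsT]
        exact h.2.2.1 i s ⟨hs.1, hsT⟩
      · rw [glue_of_le _ _ hsT]
        simp only [hyn]
        split_ifs
        exacts [le_max_right _ _, le_rfl],
    fun s _ => by
      rcases lt_or_ge s T with hsT | hsT
      · rw [glue_of_lt _ _ hsT]
      · rw [glue_of_le _ _ hsT]
        exact le_max_right _ _,
    fun s hs => by
      rcases lt_or_ge s T with hsT | hsT
      · simp only [glue_of_lt _ _ hsT]
        exact h.2.2.2.2 s ⟨hs.1, hsT⟩
      · simp only [glue_of_le _ _ hsT]
        have : ∑ i, yn i s = yc s := by simp [hyn]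
        rw [this]
        simp only [hyc, hzc]
        rcases le_total 0 (X (s - T)) with h | h
        · rw [max_eq_left h, max_eq_right (by linarith : -X (s - T) ≤ 0), min_eq_right h]
        · rw [max_eq_right h, min_eq_left (le_max_right _ _)]⟩
  have hX_nonneg : ∀ s ∈ Ico 0 b, 0 ≤ X s := fun s hs => by
    have := hidle (T + s) ⟨by linarith [hs.1], by linarith [hs.2]⟩
    rw [glue_of_le _ _ (by linarith [hs.1])] at this
    have h2 := le_max_left (-X (T + s - T)) 0
    simp only [hzc] at this
    rw [this, add_sub_cancel_left] at h2
    linarith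
  have hclos : b ∈ closure (Ico 0 b) := by
    rw [closure_Ico hb.ne]
    exact ⟨hb.le, le_rfl⟩
  exact absurd hXb (not_lt.2 (ContinuousWithinAt.closure_le (f := fun _ => (0:ℝ)) hclos
    continuousWithinAt_const hXc.continuousWithinAt hX_nonneg))

/-- In a nonidling single-pool system that has not idled before time `T`, the content at time `T`
is controlled by the input at time `T`. -/
theorem SinglePoolNonidling.abs_content_le {I : Type*} [Fintype I] (i₀ : I) {m θ : I → ℝ}
    (hm : ∀ i, 0 < m i) (hθ : ∀ i, 0 ≤ θ i) (hni : SinglePoolNonidling m θ)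
    {q y w : I → ℝ → ℝ} {T : ℝ} (hT : 0 < T) (hq : ∀ i, BddMeas (q i) T)
    (hy : ∀ i, BddMeas (y i) T) (hw : ∀ i, Continuous (w i))
    (hmono : ∀ i, StrictMonoOn (w i) (Icc 0 T)) (hw0 : ∀ i, 0 < w i 0)
    (h : SinglePool m θ q y w (fun _ => 0) (Ico 0 T)) (i : I) :
    |w i T - m i * 𝔍 (q i) T - θ i * 𝔍 (y i) T| ≤ 3 * (m i * ∑ k, w k T / m k) := by
  have hT' : T ∈ Icc 0 T := ⟨hT.le, le_rfl⟩
  have h0' : (0:ℝ) ∈ Icc 0 T := ⟨le_rfl, hT.le⟩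
  have hwT : ∀ k, 0 < w k T := fun k => (hw0 k).trans (hmono k h0' hT' hT)
  have hY : ∀ k, ∀ s ∈ Icc 0 T, 0 ≤ 𝔍 (y k) s := fun k s hs => by
    have := (hy k).le_integral (c := 0) h0' hs hs.1 fun u hu =>
      h.2.2.1 k u ⟨hu.1.le, hu.2.trans_le hs.2⟩
    rw [integral_zero_left] at this
    linarith
  have hQsum : ∑ k, 𝔍 (q k) T = 0 := by
    rw [← BddMeas.integral_sum _ hq hT', ← integral_zero_fun T]
    exact integral_congr_Ico hT.le fun u hu => by simpa using h.2.1 u hu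
  have hQle : ∀ k, 𝔍 (q k) T ≤ w k T / m k := fun k => by
    refine integral_le_div_of_le_sub_mul hT.le (hwT k).le (hm k) (hq k) fun s hs => ?_
    have h1 := h.1 k s hs
    have h2 := h.2.2.1 k s hs
    have h3 := mul_nonneg (hθ k) (hY k s ⟨hs.1, hs.2.le⟩)
    have h4 := hmono k ⟨hs.1, hs.2.le⟩ hT' hs.2
    linarith
  have hterm : ∀ k ∈ Finset.univ, 0 ≤ w k T / m k := fun k _ => (div_pos (hwT k) (hm k)).le
  have hwi : w i T / m i ≤ ∑ k, w k T / m k := Finset.single_le_sum hterm (Finset.mem_univ i)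
  have hQge : -∑ k, w k T / m k ≤ 𝔍 (q i) T := by
    have := Finset.single_le_sum (f := fun k => w k T / m k - 𝔍 (q k) T)
      (fun k _ => sub_nonneg.2 (hQle k)) (Finset.mem_univ i)
    rw [Finset.sum_sub_distrib, hQsum] at this
    have := hterm i (Finset.mem_univ i)
    linarith
  have hYle : θ i * 𝔍 (y i) T / m i ≤ ∑ k, w k T / m k := by
    have h1 := hni.workload_nonneg i₀ hm hθ hT hq hy hw hmono hw0 h
    have h2 : ∑ k, (w k T - m k * 𝔍 (q k) T - θ k * 𝔍 (y k) T) / m k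
        = ∑ k, w k T / m k - ∑ k, 𝔍 (q k) T - ∑ k, θ k * 𝔍 (y k) T / m k := by
      rw [← Finset.sum_sub_distrib, ← Finset.sum_sub_distrib]
      refine Finset.sum_congr rfl fun k _ => ?_
      have := (hm k).ne'
      field_simp
    have h3 := Finset.single_le_sum (f := fun k => θ k * 𝔍 (y k) T / m k)
      (fun k _ => div_nonneg (mul_nonneg (hθ k) (hY k T hT')) (hm k).le) (Finset.mem_univ i)
    rw [hQsum] at h2
    linarith
  have hmi := hm i
  set R := ∑ k, w k T / m k
  have b1 : w i T ≤ m i * R := by rwa [div_le_iff₀' hmi] at hwi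
  have b2 : θ i * 𝔍 (y i) T ≤ m i * R := by rwa [div_le_iff₀' hmi] at hYle
  have b3 : m i * 𝔍 (q i) T ≤ m i * R := mul_le_mul_of_nonneg_left ((hQle i).trans hwi) hmi.le
  have b4 : m i * -R ≤ m i * 𝔍 (q i) T := mul_le_mul_of_nonneg_left hQge hmi.le
  have b5 := mul_nonneg (hθ i) (hY i T hT')
  have b6 := hwT i
  rw [abs_le]
  constructor <;> linarith

/-- If no station idles before time `T`, only station `j₀` is active. -/
theorem Sys.eq_zero_of_ne {I J : Type*} [Fintype I] [Fintype J] {i₀ : I} {j₀ : J}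
    {μ : I × J → ℝ} {θ : I → ℝ} {ψ : I → J → ℝ → ℝ} {y w : I → ℝ → ℝ} {z : J → ℝ → ℝ} {T : ℝ}
    (h : Sys i₀ j₀ μ θ ψ y w z (Ico 0 T)) (hz : ∀ j, ∀ t ∈ Ico 0 T, z j t = 0)
    (i : I) {j : J} (hj : j ≠ j₀) :
    ∀ t ∈ Ico 0 T, ψ i j t = 0 := by
  intro t ht
  by_cases hi : i = i₀
  · have h2 := h.2.2.1 j t ht
    rw [Finset.sum_eq_single i, hz j t ht, neg_zero] at h2
    · exact h2
    · exact fun k _ hk => h.1 k j (by rw [← hi]; tauto) t ht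
    · simp
  · exact h.1 i j (by tauto) t ht

/-- If no station idles before time `T`, only station `j₀` contributes to the served content. -/
theorem Sys.sum_mul_integral {I J : Type*} [Fintype I] [Fintype J] {i₀ : I} {j₀ : J}
    {μ : I × J → ℝ} {θ : I → ℝ} {ψ : I → J → ℝ → ℝ} {y w : I → ℝ → ℝ} {z : J → ℝ → ℝ} {T : ℝ}
    (h : Sys i₀ j₀ μ θ ψ y w z (Ico 0 T)) (hz : ∀ j, ∀ t ∈ Ico 0 T, z j t = 0)
    (i : I) {s : ℝ} (hs : s ∈ Icc 0 T) :
    ∑ j, μ (i, j) * 𝔍 (ψ i j) s = μ (i, j₀) * 𝔍 (ψ i j₀) s := by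
  refine Finset.sum_eq_single j₀ (fun j _ hj => ?_) (by simp)
  rw [integral_congr_Ico (g := fun _ => 0) hs.1 fun u hu =>
    h.eq_zero_of_ne hz i hj u ⟨hu.1, hu.2.trans_le hs.2⟩, integral_zero_fun, mul_zero]

/-- A solution in which no station idles solves the system with the single station `j₀`. -/
theorem Sys.singlePool {I J : Type*} [Fintype I] [Fintype J] {i₀ : I} {j₀ : J}
    {μ : I × J → ℝ} {θ : I → ℝ} {ψ : I → J → ℝ → ℝ} {y w : I → ℝ → ℝ} {z : J → ℝ → ℝ} {T : ℝ}
    (h : Sys i₀ j₀ μ θ ψ y w z (Ico 0 T)) (hz : ∀ j, ∀ t ∈ Ico 0 T, z j t = 0) :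
    SinglePool (fun i => μ (i, j₀)) θ (fun i => ψ i j₀) y w (fun _ => 0) (Ico 0 T) := by
  refine ⟨fun i t ht => ?_, fun t ht => ?_, h.2.2.2.1, fun _ _ => le_rfl, fun t ht => ?_⟩
  · have h1 := h.2.1 i t ht
    rw [Finset.sum_add_distrib, h.sum_mul_integral hz i ⟨ht.1, ht.2.le⟩,
      Finset.sum_eq_single j₀ (fun j _ hj => h.eq_zero_of_ne hz i hj t ht) (by simp)] at h1
    exact h1
  · rw [h.2.2.1 j₀ t ht, hz j₀ t ht]
  · have := h.2.2.2.2.2 t ht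
    rwa [Finset.sum_eq_zero fun j _ => hz j t ht] at this

/-- Adding suitable extra content to the classes turns any solution whose input is bounded by
`K - 1` into one with strictly increasing input, and changes the content at time `T` by at most
`2 * K + L * T`. -/
theorem Sys.exists_strictMono {I J : Type*} [Fintype I] [Fintype J] {i₀ : I} {j₀ : J}
    {μ : I × J → ℝ} {θ : I → ℝ} (hμ : ∀ i j, 0 ≤ μ (i, j)) (hθ : ∀ i, 0 ≤ θ i)
    {ψ : I → J → ℝ → ℝ} {y w : I → ℝ → ℝ} {z : J → ℝ → ℝ} {T K L : ℝ} (hT : 0 < T)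
    (hψb : ∀ i j, BddMeas (ψ i j) T) (hyb : ∀ i, BddMeas (y i) T) (hwb : ∀ i, BddMeas (w i) T)
    (hzb : ∀ j, BddMeas (z j) T) (h : Sys i₀ j₀ μ θ ψ y w z (Icc 0 T))
    (hK : ∀ i, ∀ s ∈ Icc 0 T, |w i s| + 1 ≤ K)
    (hL : 1 + μ (i₀, j₀) * (Fintype.card I * (2 * K + T)) = L) :
    ∃ (ψ' : I → J → ℝ → ℝ) (y' w' : I → ℝ → ℝ) (z' : J → ℝ → ℝ),
      (∀ i j, BddMeas (ψ' i j) T) ∧ (∀ i, BddMeas (y' i) T) ∧ (∀ j, BddMeas (z' j) T) ∧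
      (∀ i, Continuous (w' i)) ∧ (∀ i, StrictMonoOn (w' i) (Icc 0 T)) ∧ (∀ i, 0 < w' i 0) ∧
      Sys i₀ j₀ μ θ ψ' y' w' z' (Ico 0 T) ∧
      (∀ i, w' i T ≤ (2 * K + L * T) * (1 + (∑ k, (μ (k, j₀) + θ k)
        + (∑ j, μ (i₀, j)) * Fintype.card I) * T)) ∧
      (∀ i, |w i T - ∑ j, μ (i, j) * 𝔍 (ψ i j) T - θ i * 𝔍 (y i) T| ≤ 2 * K + L * T
        + |w' i T - ∑ j, μ (i, j) * 𝔍 (ψ' i j) T - θ i * 𝔍 (y' i) T|) := by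
  classical
  obtain ⟨e0, e1, e2, e3, e4, e5⟩ := h
  have hT' : T ∈ Icc 0 T := ⟨hT.le, le_rfl⟩
  have h0' : (0:ℝ) ∈ Icc 0 T := ⟨le_rfl, hT.le⟩
  have hK1 : 1 ≤ K := by
    have := hK i₀ 0 h0'
    have := abs_nonneg (w i₀ 0)
    linarith
  have hM := hμ i₀ j₀
  have hL1 : 1 ≤ L := by
    rw [← hL]
    have : 0 ≤ μ (i₀, j₀) * (Fintype.card I * (2 * K + T)) := by positivity
    linarith
  set P := 2 * K + L * T with hP
  set ℓ : I → ℝ := fun i => if i = i₀ then L else 1 with hℓ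
  have hℓL : ∀ i, ℓ i ≤ L := fun i => by simp only [hℓ]; split_ifs <;> linarith
  have hℓ1 : ∀ i, 1 ≤ ℓ i := fun i => by simp only [hℓ]; split_ifs <;> linarith
  set φ : I → ℝ → ℝ := fun i s => K + ℓ i * s - w i s with hφ
  have hφ1 : ∀ i, ∀ s ∈ Icc 0 T, 1 ≤ φ i s := fun i s hs => by
    have h1 := hK i s hs
    have h2 := le_abs_self (w i s)
    have h3 := mul_nonneg (zero_le_one.trans (hℓ1 i)) hs.1
    simp only [hφ]
    linarith
  have hφle : ∀ i, ∀ s ∈ Icc 0 T, φ i s ≤ 2 * K + ℓ i * T := fun i s hs => by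
    have h1 := hK i s hs
    have h2 := neg_abs_le (w i s)
    have h3 := mul_le_mul_of_nonneg_left hs.2 (zero_le_one.trans (hℓ1 i))
    simp only [hφ]
    linarith
  have hφP : ∀ i, ∀ s ∈ Icc 0 T, φ i s ≤ P := fun i s hs => by
    have := mul_le_mul_of_nonneg_right (hℓL i) hT.le
    linarith [hφle i s hs]
  have hφb : ∀ i, BddMeas (φ i) T := fun i =>
    BddMeas.sub (.of_continuous (by fun_prop)) (hwb i)
  set Φ : ℝ → ℝ := fun s => ∑ i, φ i s with hΦ
  set Z : ℝ → ℝ := fun s => ∑ j, z j s with hZ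
  have hΦb : BddMeas Φ T := BddMeas.sum _ hφb
  have hZb : BddMeas Z T := BddMeas.sum _ hzb
  have hΦ1 : ∀ s ∈ Icc 0 T, 0 < Φ s := fun s hs =>
    Finset.sum_pos (fun i _ => zero_lt_one.trans_le (hφ1 i s hs)) ⟨i₀, Finset.mem_univ _⟩
  have hΦP : ∀ s ∈ Icc 0 T, Φ s ≤ Fintype.card I * P := fun s hs => by
    have := Finset.sum_le_card_nsmul Finset.univ (fun i => φ i s) P fun i _ => hφP i s hs
    simpa using this
  have hZ0 : ∀ s ∈ Icc 0 T, 0 ≤ Z s := fun s hs => Finset.sum_nonneg fun j _ => e4 j s hs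
  set a : ℝ → ℝ := fun s => min (Z s) (Φ s) with ha
  have haZ : ∀ s, a s ≤ Z s := fun s => min_le_left _ _
  have haΦ : ∀ s, a s ≤ Φ s := fun s => min_le_right _ _
  have ha0 : ∀ s ∈ Icc 0 T, 0 ≤ a s := fun s hs => le_min (hZ0 s hs) (hΦ1 s hs).le
  have ham : Measurable a := hZb.1.min hΦb.1
  set γ : ℝ → ℝ := fun s => a s / Φ s with hγ
  set α : ℝ → ℝ := fun s => a s / Z s with hα
  have hγ0 : ∀ s ∈ Icc 0 T, 0 ≤ γ s := fun s hs => div_nonneg (ha0 s hs) (hΦ1 s hs).le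
  have hγ1 : ∀ s ∈ Icc 0 T, γ s ≤ 1 := fun s hs => div_le_one_of_le₀ (haΦ s) (hΦ1 s hs).le
  have hα0 : ∀ s ∈ Icc 0 T, 0 ≤ α s := fun s hs => div_nonneg (ha0 s hs) (hZ0 s hs)
  have hα1 : ∀ s ∈ Icc 0 T, α s ≤ 1 := fun s hs => div_le_one_of_le₀ (haZ s) (hZ0 s hs)
  have hγΦ : ∀ s ∈ Icc 0 T, γ s * Φ s = a s := fun s hs => div_mul_cancel₀ _ (hΦ1 s hs).ne'
  have hαZ : ∀ s ∈ Icc 0 T, α s * Z s = a s := fun s hs => by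
    rcases (hZ0 s hs).eq_or_lt with h0 | h0
    · have h1 := haZ s
      have h2 := ha0 s hs
      rw [← h0] at h1 ⊢
      linarith
    · exact div_mul_cancel₀ _ h0.ne'
  have hγφb : ∀ i, BddMeas (fun s => γ s * φ i s) T := fun i =>
    BddMeas.of_abs_le ((ham.div hΦb.1).mul (hφb i).1) (hφb i) fun s hs => by
      rw [abs_mul, abs_of_nonneg (hγ0 s hs)]
      exact mul_le_of_le_one_left (abs_nonneg _) (hγ1 s hs)
  have hαzb : ∀ j, BddMeas (fun s => α s * z j s) T := fun j =>
    BddMeas.of_abs_le ((ham.div hZb.1).mul (hzb j).1) (hzb j) fun s hs => by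
      rw [abs_mul, abs_of_nonneg (hα0 s hs)]
      exact mul_le_of_le_one_left (abs_nonneg _) (hα1 s hs)
  have hab : BddMeas a T := BddMeas.of_abs_le ham hΦb fun s hs => by
    rw [abs_of_nonneg (ha0 s hs), abs_of_nonneg (hΦ1 s hs).le]
    exact haΦ s
  have hzero : BddMeas (fun _ => (0:ℝ)) T := .of_continuous continuous_const
  set D : I → J → ℝ → ℝ := fun i j s => (if j = j₀ then γ s * φ i s else 0)
    + ((if i = i₀ then α s * z j s else 0) - if i = i₀ ∧ j = j₀ then a s else 0) with hD
  have hDb : ∀ i j, BddMeas (D i j) T := fun i j => by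
    refine BddMeas.add ?_ (BddMeas.sub ?_ ?_)
    · split_ifs
      exacts [hγφb i, hzero]
    · split_ifs
      exacts [hαzb j, hzero]
    · split_ifs
      exacts [hab, hzero]
  set e : I → ℝ → ℝ := fun i s => φ i s - γ s * φ i s with he
  have heb : ∀ i, BddMeas (e i) T := fun i => (hφb i).sub (hγφb i)
  have he0 : ∀ i, ∀ s ∈ Icc 0 T, 0 ≤ e i s := fun i s hs => by
    have := mul_le_of_le_one_left (zero_le_one.trans (hφ1 i s hs)) (hγ1 s hs)
    simp only [he]
    linarith
  have hγφ0 : ∀ i, ∀ s ∈ Icc 0 T, 0 ≤ γ s * φ i s := fun i s hs =>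
    mul_nonneg (hγ0 s hs) (zero_le_one.trans (hφ1 i s hs))
  have hαz0 : ∀ j, ∀ s ∈ Icc 0 T, 0 ≤ α s * z j s := fun j s hs =>
    mul_nonneg (hα0 s hs) (e4 j s hs)
  have hDi : ∀ i, ∀ s ∈ Icc 0 T, ∑ j, D i j s = γ s * φ i s := fun i s hs => by
    simp only [hD, Finset.sum_add_distrib, Finset.sum_sub_distrib]
    by_cases hi : i = i₀
    · simp [hi, ← Finset.mul_sum]
      exact sub_eq_zero.2 (hαZ s hs)
    · simp [hi]
  have hDj : ∀ j, ∀ s ∈ Icc 0 T, ∑ i, D i j s = α s * z j s := fun j s hs => by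
    simp only [hD, Finset.sum_add_distrib, Finset.sum_sub_distrib]
    by_cases hj : j = j₀
    · simp [hj, ← Finset.mul_sum]
      have := hγΦ s hs
      simp only [hΦ] at this
      linarith
    · simp [hj]
  set G : I → ℝ → ℝ := fun i s => ∑ j, μ (i, j) * D i j s + θ i * e i s with hG
  have hGb : ∀ i, BddMeas (G i) T := fun i =>
    (BddMeas.sum _ fun j => (hDb i j).const_mul _).add ((heb i).const_mul _)
  have hGeq : ∀ i s, G i s = μ (i, j₀) * (γ s * φ i s) + (if i = i₀ then
      ∑ j, μ (i, j) * (α s * z j s) - μ (i, j₀) * a s else 0) + θ i * e i s := fun i s => by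
    simp only [hG, hD, mul_add, mul_sub, Finset.sum_add_distrib, Finset.sum_sub_distrib]
    by_cases hi : i = i₀
    · simp [hi]
    · simp [hi]
  have hGlow : ∀ i, ∀ s ∈ Icc 0 T, 1 - ℓ i ≤ G i s := fun i s hs => by
    rw [hGeq]
    have h1 := mul_nonneg (hμ i j₀) (hγφ0 i s hs)
    have h2 := mul_nonneg (hθ i) (he0 i s hs)
    by_cases hi : i = i₀
    · subst hi
      have h3 : 0 ≤ ∑ j, μ (i, j) * (α s * z j s) := Finset.sum_nonneg fun j _ =>
        mul_nonneg (hμ i j) (hαz0 j s hs)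
      have h4 : a s - γ s * φ i s ≤ Fintype.card I * (2 * K + T) := by
        rw [← hγΦ s hs, ← mul_sub]
        have h5 : Φ s - φ i s = ∑ k ∈ Finset.univ.erase i, φ k s := by
          rw [Finset.sum_erase_eq_sub (Finset.mem_univ i)]
        have h6 : 0 ≤ Φ s - φ i s := by
          rw [h5]
          exact Finset.sum_nonneg fun k _ => zero_le_one.trans (hφ1 k s hs)
        refine (mul_le_of_le_one_left h6 (hγ1 s hs)).trans ?_
        rw [h5]
        have h7 := Finset.sum_le_card_nsmul (Finset.univ.erase i) (fun k => φ k s) (2 * K + T)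
          fun k hk => by
            have := hφle k s hs
            simpa only [hℓ, if_neg (Finset.ne_of_mem_erase hk), one_mul] using this
        rw [nsmul_eq_mul] at h7
        refine h7.trans (mul_le_mul_of_nonneg_right ?_ (by positivity))
        exact_mod_cast Finset.card_le_univ _
      have h8 := mul_le_mul_of_nonneg_left h4 hM
      simp only [hℓ, if_true]
      linarith
    · simp only [hℓ, if_neg hi]
      linarith
  set c := ∑ k, (μ (k, j₀) + θ k) + (∑ j, μ (i₀, j)) * Fintype.card I with hc
  have hP0 : 0 ≤ P := by positivity
  have hGup : ∀ i, ∀ s ∈ Icc 0 T, G i s ≤ c * P := fun i s hs => by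
    rw [hGeq]
    have h1 : μ (i, j₀) * (γ s * φ i s) ≤ μ (i, j₀) * P := by
      refine mul_le_mul_of_nonneg_left ?_ (hμ i j₀)
      have := he0 i s hs
      simp only [he] at this
      linarith [hφP i s hs]
    have h2 : θ i * e i s ≤ θ i * P := by
      refine mul_le_mul_of_nonneg_left ?_ (hθ i)
      have := hγφ0 i s hs
      simp only [he]
      linarith [hφP i s hs]
    have h3 : μ (i, j₀) + θ i ≤ ∑ k, (μ (k, j₀) + θ k) :=
      Finset.single_le_sum (f := fun k => μ (k, j₀) + θ k)
        (fun k _ => add_nonneg (hμ k j₀) (hθ k)) (Finset.mem_univ i)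
    have h4 := mul_le_mul_of_nonneg_right h3 hP0
    have h5 : (if i = i₀ then ∑ j, μ (i, j) * (α s * z j s) - μ (i, j₀) * a s else 0)
        ≤ (∑ j, μ (i₀, j)) * (Fintype.card I * P) := by
      split_ifs with hi
      · subst hi
        have h6 : ∑ j, μ (i, j) * (α s * z j s) ≤ ∑ j, μ (i, j) * (Fintype.card I * P) := by
          refine Finset.sum_le_sum fun j _ => mul_le_mul_of_nonneg_left ?_ (hμ i j)
          refine (mul_le_mul_of_nonneg_left ?_ (hα0 s hs)).trans
            ((hαZ s hs).le.trans ((haΦ s).trans (hΦP s hs)))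
          exact Finset.single_le_sum (f := fun j => z j s) (fun j _ => e4 j s hs)
            (Finset.mem_univ j)
        rw [← Finset.sum_mul] at h6
        have := mul_nonneg (hμ i j₀) (ha0 s hs)
        linarith
      · exact mul_nonneg (Finset.sum_nonneg fun j _ => hμ i₀ j) (by positivity)
    rw [hc]
    linarith
  set w' : I → ℝ → ℝ := fun i s => K + ℓ i * s + 𝔍 ((Icc 0 T).indicator (G i)) s with hw'
  have hind : ∀ i, ∀ s ∈ Icc 0 T, 𝔍 ((Icc 0 T).indicator (G i)) s = 𝔍 (G i) s :=
    fun i s hs => integral_congr_Ico hs.1 fun u hu =>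
      indicator_of_mem (show u ∈ Icc 0 T from ⟨hu.1, hu.2.le.trans hs.2⟩) _
  have hGint : ∀ i, ∀ s ∈ Icc 0 T,
      𝔍 (G i) s = ∑ j, μ (i, j) * 𝔍 (D i j) s + θ i * 𝔍 (e i) s := fun i s hs => by
    simp only [hG]
    rw [BddMeas.integral_add (BddMeas.sum _ fun j => (hDb i j).const_mul _)
      ((heb i).const_mul _) hs, BddMeas.integral_sum _ (fun j => (hDb i j).const_mul _) hs]
    simp only [integral_const_mul_fun]
  have hψint : ∀ i, ∀ s ∈ Icc 0 T, ∑ j, μ (i, j) * 𝔍 (fun s => ψ i j s + D i j s) s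
      = ∑ j, μ (i, j) * 𝔍 (ψ i j) s + ∑ j, μ (i, j) * 𝔍 (D i j) s := fun i s hs => by
    rw [← Finset.sum_add_distrib]
    exact Finset.sum_congr rfl fun j _ => by
      rw [(hψb i j).integral_add (hDb i j) hs, mul_add]
  have hcontent : ∀ i, ∀ s ∈ Icc 0 T, w' i s - ∑ j, μ (i, j) * 𝔍 (fun s => ψ i j s + D i j s) s
      - θ i * 𝔍 (fun s => y i s + e i s) s
      = (w i s - ∑ j, μ (i, j) * 𝔍 (ψ i j) s - θ i * 𝔍 (y i) s) + φ i s := fun i s hs => by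
    rw [hψint i s hs, (hyb i).integral_add (heb i) hs]
    simp only [hw', hφ]
    rw [hind i s hs, hGint i s hs]
    ring
  refine ⟨fun i j s => ψ i j s + D i j s, fun i s => y i s + e i s, w',
    fun j s => z j s - α s * z j s, fun i j => (hψb i j).add (hDb i j),
    fun i => (hyb i).add (heb i), fun j => (hzb j).sub (hαzb j), fun i => ?_, fun i => ?_,
    fun i => ?_, ⟨fun i j hij t ht => ?_, fun i t ht => ?_, fun j t ht => ?_, fun i t ht => ?_,
      fun j t ht => ?_, fun t ht => ?_⟩, fun i => ?_, fun i => ?_⟩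
  · have hGI : Integrable ((Icc 0 T).indicator (G i)) := by
      rw [integrable_indicator_iff measurableSet_Icc,
        ← intervalIntegrable_iff_integrableOn_Icc_of_le hT.le]
      exact (hGb i).intervalIntegrable h0' hT'
    have := intervalIntegral.continuous_primitive (μ := volume)
      (fun _ _ => hGI.intervalIntegrable) 0
    exact (by fun_prop : Continuous fun s => K + ℓ i * s).add this
  · intro s hs u hu hsu
    simp only [hw']
    rw [hind i s hs, hind i u hu]
    have := (hGb i).le_integral hs hu hsu.le fun r hr =>
      hGlow i r ⟨hs.1.trans hr.1.le, hr.2.le.trans hu.2⟩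
    linarith
  · simp only [hw', integral_zero_left]
    linarith
  · have hj : j ≠ j₀ := by tauto
    have hi : i ≠ i₀ := by tauto
    simp [hD, e0 i j hij t ⟨ht.1, ht.2.le⟩, hj, hi]
  · have ht' : t ∈ Icc 0 T := ⟨ht.1, ht.2.le⟩
    have h1 := hcontent i t ht'
    have h2 := e1 i t ht'
    have h3 := hDi i t ht'
    simp only [Finset.sum_add_distrib] at h2 ⊢
    simp only [he] at h1 ⊢
    linarith
  · have ht' : t ∈ Icc 0 T := ⟨ht.1, ht.2.le⟩
    rw [Finset.sum_add_distrib, e2 j t ht', hDj j t ht']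
    ring
  · exact add_nonneg (e3 i t ⟨ht.1, ht.2.le⟩) (he0 i t ⟨ht.1, ht.2.le⟩)
  · exact sub_nonneg.2 (mul_le_of_le_one_left (e4 j t ⟨ht.1, ht.2.le⟩) (hα1 t ⟨ht.1, ht.2.le⟩))
  · have ht' : t ∈ Icc 0 T := ⟨ht.1, ht.2.le⟩
    have h1 : ∑ i, (y i t + e i t) = ∑ i, y i t + (Φ t - a t) := by
      simp only [he, Finset.sum_add_distrib, Finset.sum_sub_distrib, ← Finset.mul_sum]
      rw [← hγΦ t ht']
    have h2 : ∑ j, (z j t - α t * z j t) = Z t - a t := by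
      rw [Finset.sum_sub_distrib, ← Finset.mul_sum, ← hαZ t ht']
    have h3 := e5 t ht'
    have h4 := Finset.sum_nonneg fun i (_ : i ∈ Finset.univ) => e3 i t ht'
    rw [h1, h2]
    rcases le_total (Z t) (Φ t) with hle | hle
    · have : a t = Z t := min_eq_left hle
      rw [this, sub_self]
      exact min_eq_right (by linarith)
    · have : a t = Φ t := min_eq_right hle
      have hZpos : 0 < Z t := (hΦ1 t ht').trans_le hle
      have hy0 : ∑ i, y i t = 0 := by
        rcases min_choice (∑ i, y i t) (∑ j, z j t) with h5 | h5
        · rw [← h5, h3]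
        · rw [h5] at h3
          exact absurd h3 hZpos.ne'
      rw [this, sub_self, hy0, add_zero]
      exact min_eq_left (by linarith)
  · simp only [hw']
    rw [hind i T hT']
    have h1 := (hGb i).integral_le h0' hT' hT.le fun r hr => hGup i r ⟨hr.1.le, hr.2.le⟩
    rw [integral_zero_left] at h1
    have h2 := mul_le_mul_of_nonneg_right (hℓL i) hT.le
    linarith
  · have h1 := hcontent i T hT'
    rw [h1]
    have h2 := hφP i T hT'
    have h3 := hφ1 i T hT'
    set x := w i T - ∑ j, μ (i, j) * 𝔍 (ψ i j) T - θ i * 𝔍 (y i) T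
    have h4 := abs_sub_le (x + φ i T) (φ i T) 0
    have h5 := abs_sub (x + φ i T) (φ i T)
    rw [add_sub_cancel_right, abs_of_nonneg (zero_le_one.trans h3)] at h5
    linarith

theorem one_add_rpow_ge_cube {t m : ℝ} (ht : 0 ≤ t) (hm : 3 ≤ m) : (1 + t) ^ 3 ≤ (1 + t) ^ m := by
  rw [← Real.rpow_natCast]
  exact Real.rpow_le_rpow_of_exponent_le (by linarith) (by exact_mod_cast hm)

theorem Sys.mono {I J : Type*} [Fintype I] [Fintype J] {i₀ : I} {j₀ : J}
    {μ : I × J → ℝ} {θ : I → ℝ} {ψ : I → J → ℝ → ℝ} {y w : I → ℝ → ℝ} {z : J → ℝ → ℝ}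
    {S S' : Set ℝ} (h : Sys i₀ j₀ μ θ ψ y w z S) (hS : S' ⊆ S) :
    Sys i₀ j₀ μ θ ψ y w z S' :=
  ⟨fun i j hij t ht => h.1 i j hij t (hS ht), fun i t ht => h.2.1 i t (hS ht),
    fun j t ht => h.2.2.1 j t (hS ht), fun i t ht => h.2.2.2.1 i t (hS ht),
    fun j t ht => h.2.2.2.2.1 j t (hS ht), fun t ht => h.2.2.2.2.2 t (hS ht)⟩

/-- Theorem 3: for a tree of diameter at most 3, the nonidling property
implies the polynomial-in-time estimate
`∑_i |x_i(t)| ≤ m₄ (1+t)^{m₄} (1 + sup_{0≤s≤t} ∑_i |w_i(s)|)`, where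
`x_i = w_i − ∑_j μ_ij 𝔍ψ_ij − θ_i 𝔍y_i`. -/
theorem nonidling_implies_estimate
    {I J : Type*} [Fintype I] [Fintype J] [Nonempty I] [Nonempty J]
    (i₀ : I) (j₀ : J) (μ : I × J → ℝ) (θ : I → ℝ)
    (hμpos : ∀ i j, (j = j₀ ∨ i = i₀) → 0 < μ (i, j))
    (hμzero : ∀ i j, ¬(j = j₀ ∨ i = i₀) → μ (i, j) = 0)
    (hθ : ∀ i, 0 ≤ θ i)
    (hni : Nonidling i₀ j₀ μ θ) :
    ∃ m₄ : ℝ, 0 < m₄ ∧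
      ∀ (ψ : I → J → ℝ → ℝ) (y w : I → ℝ → ℝ) (z : J → ℝ → ℝ),
        (∀ i j, MeasLBInf (ψ i j)) → (∀ i, MeasLBInf (y i)) →
        (∀ i, MeasLBInf (w i)) → (∀ j, MeasLBInf (z j)) →
        Sys i₀ j₀ μ θ ψ y w z (Ici (0:ℝ)) →
        ∀ t : ℝ, 0 ≤ t →
          ∑ i, |w i t - ∑ j, μ (i, j) * 𝔍 (ψ i j) t - θ i * 𝔍 (y i) t| ≤
            m₄ * (1 + t) ^ m₄ *
              (1 + sSup ((fun s => ∑ i, |w i s|) '' Icc 0 t)) := by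
  classical
  have hμ : ∀ i j, 0 ≤ μ (i, j) := fun i j => by
    by_cases h : j = j₀ ∨ i = i₀
    exacts [(hμpos i j h).le, (hμzero i j h).ge]
  have hm : ∀ i, 0 < μ (i, j₀) := fun i => hμpos i j₀ (.inl rfl)
  set n := (Fintype.card I : ℝ) with hn
  set M := μ (i₀, j₀) with hM
  set c := ∑ k, (μ (k, j₀) + θ k) + (∑ j, μ (i₀, j)) * n with hc
  set A := ∑ i, μ (i, j₀) with hA
  set R := ∑ i, 1 / μ (i, j₀) with hR
  have hn0 : 0 ≤ n := Nat.cast_nonneg _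
  have hM0 : 0 ≤ M := hμ i₀ j₀
  have hc0 : 0 ≤ c := add_nonneg (Finset.sum_nonneg fun k _ => add_nonneg (hμ k j₀) (hθ k))
    (mul_nonneg (Finset.sum_nonneg fun j _ => hμ i₀ j) hn0)
  have hA0 : 0 ≤ A := Finset.sum_nonneg fun i _ => (hm i).le
  have hR0 : 0 ≤ R := Finset.sum_nonneg fun i _ => (one_div_pos.2 (hm i)).le
  set B := n + 3 * A * R * (1 + c) with hB
  have hB0 : 0 ≤ B := by positivity
  refine ⟨max 3 (B * (3 + 2 * M * n)), by positivity, ?_⟩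
  intro ψ y w z hψ hy hw hz h t ht
  set m₄ := max 3 (B * (3 + 2 * M * n)) with hm₄
  set K := 1 + sSup ((fun s => ∑ i, |w i s|) '' Icc 0 t) with hKdef
  have hbdd : BddAbove ((fun s => ∑ i, |w i s|) '' Icc 0 t) := by
    choose C hC using fun i => ((hw i).bddMeas ht).2
    exact ⟨∑ i, C i, by
      rintro _ ⟨s, hs, rfl⟩
      exact Finset.sum_le_sum fun i _ => hC i s hs⟩
  have hsum : ∀ s ∈ Icc 0 t, ∑ i, |w i s| + 1 ≤ K := fun s hs => by
    linarith [le_csSup hbdd ⟨s, hs, rfl⟩]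
  have hK : ∀ i, ∀ s ∈ Icc 0 t, |w i s| + 1 ≤ K := fun i s hs =>
    (add_le_add_left (Finset.single_le_sum (f := fun i => |w i s|) (fun _ _ => abs_nonneg _)
      (Finset.mem_univ i)) 1).trans (hsum s hs)
  have hK1 : 1 ≤ K := by
    have := hK i₀ 0 ⟨le_rfl, ht⟩
    linarith [abs_nonneg (w i₀ 0)]
  rcases ht.eq_or_lt with rfl | ht0
  · have := hsum 0 ⟨le_rfl, le_rfl⟩
    simp only [integral_zero_left, mul_zero, Finset.sum_const_zero, sub_zero, add_zero,
      Real.one_rpow, mul_one]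
    have : 1 ≤ m₄ := le_max_of_le_left (by norm_num)
    have := le_mul_of_one_le_left (zero_le_one.trans hK1) this
    linarith
  obtain ⟨ψ', y', w', z', hψ', hy', hz', hwc, hmono, hw0, hsys, hwT, hx⟩ :=
    Sys.exists_strictMono hμ hθ ht0 (fun i j => (hψ i j).bddMeas ht) (fun i => (hy i).bddMeas ht)
      (fun i => (hw i).bddMeas ht) (fun j => (hz j).bddMeas ht) (h.mono Icc_subset_Ici_self) hK rfl
  have hz0 := hni t ht0 ψ' y' w' z' (fun i j => (hψ' i j).measLB) (fun i => (hy' i).measLB)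
    (fun i => (BddMeas.of_continuous (hwc i)).measLB) (fun j => (hz' j).measLB)
    (fun i s _ => (hwc i).continuousWithinAt) (fun i => (hmono i).mono Ico_subset_Icc_self) hw0 hsys
  set P := 2 * K + (1 + M * (n * (2 * K + t))) * t with hP
  have hP0 : 0 ≤ P := by positivity
  have hx' : ∀ i, |w i t - ∑ j, μ (i, j) * 𝔍 (ψ i j) t - θ i * 𝔍 (y i) t| ≤
      P + 3 * (μ (i, j₀) * (P * (1 + c * t) * R)) := fun i => by
    refine (hx i).trans (add_le_add_right ?_ P)
    rw [hsys.sum_mul_integral hz0 i ⟨ht, le_rfl⟩]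
    refine (hni.singlePool.abs_content_le i₀ hm hθ ht0 (fun i => hψ' i j₀) hy' hwc hmono hw0
      (hsys.singlePool hz0) i).trans ?_
    refine mul_le_mul_of_nonneg_left (mul_le_mul_of_nonneg_left ?_ (hm i).le) (by norm_num)
    rw [hR, Finset.mul_sum]
    refine Finset.sum_le_sum fun k _ => ?_
    rw [mul_one_div]
    exact div_le_div_of_nonneg_right (hwT k) (hm k).le
  calc ∑ i, |w i t - ∑ j, μ (i, j) * 𝔍 (ψ i j) t - θ i * 𝔍 (y i) t|
      ≤ ∑ i, (P + 3 * (μ (i, j₀) * (P * (1 + c * t) * R))) := Finset.sum_le_sum fun i _ => hx' i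
    _ = P * (n + 3 * A * R * (1 + c * t)) := by
      rw [Finset.sum_add_distrib, ← Finset.mul_sum, ← Finset.sum_mul, Finset.sum_const,
        Finset.card_univ, nsmul_eq_mul]
      ring
    _ ≤ P * (B * (1 + t)) := by
      refine mul_le_mul_of_nonneg_left ?_ hP0
      have h1 : 0 ≤ n * t := by positivity
      have h2 : 0 ≤ 3 * A * R * (c + t) := by positivity
      rw [hB]
      linarith
    _ ≤ K * (1 + t) ^ 2 * (3 + 2 * M * n) * (B * (1 + t)) := by
      refine mul_le_mul_of_nonneg_right ?_ (by positivity)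
      have h1 : 0 ≤ (K - 1) * t := mul_nonneg (by linarith) ht
      have h2 : 0 ≤ K * t := by positivity
      have h3 : 0 ≤ K * t ^ 2 := by positivity
      have h4 : 0 ≤ M * n * ((K - 1) * t ^ 2) :=
        mul_nonneg (by positivity) (mul_nonneg (by linarith) (by positivity))
      have h5 : 0 ≤ M * n * K := by positivity
      have h6 : 0 ≤ M * n * K * t := by positivity
      have h7 : 0 ≤ M * n * K * t ^ 2 := by positivity
      linarith
    _ = B * (3 + 2 * M * n) * (1 + t) ^ 3 * K := by ring
    _ ≤ m₄ * (1 + t) ^ m₄ * K := by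
      refine mul_le_mul_of_nonneg_right ?_ (by linarith)
      exact mul_le_mul (le_max_right _ _) (one_add_rpow_ge_cube ht (le_max_left _ _))
        (by positivity) (by positivity)
end

section
/- Assume in addition that θ_i ≤ μ_ij for every (i,j) ∈ E. Then there exists a constant m₄ > 0, depending only on I, J, i₀, j₀, μ and θ, such that every family of measurable, locally bounded functions (ψ_ij, y_i, z_j, w_i) satisfying (66)–(69) on [0,∞) with w right-continuous obeys, for all t ≥ 0: ∑_{i∈I} |x_i(t)| ≤ m₄ (1+t)^{m₄} (1 + sup_{0≤s≤t} ∑_{i∈I} |w_i(s)|), where x_i(t) = w_i(t) − ∑_{j∈J} μ_ij (𝔍ψ_ij)(t) − θ_i (𝔍y_i)(t). -/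
open MeasureTheory Set

lemma MeasLBInf.intervalIntegrable {f : ℝ → ℝ} (hf : MeasLBInf f) {t : ℝ} (ht : 0 ≤ t) :
    IntervalIntegrable f volume 0 t := by
  obtain ⟨C, hC⟩ := hf.2 t ht
  rw [intervalIntegrable_iff_integrableOn_Icc_of_le ht]
  exact Measure.integrableOn_of_bounded (M := C) (by simp) hf.1.aestronglyMeasurable
    ((ae_restrict_mem measurableSet_Icc).mono fun s hs => hC s hs)

/-- A primitive that starts at `0` and does not increase while above `K ≥ 0` stays below `K`. -/
lemma integral_le_of_integrand_nonpos {g : ℝ → ℝ} {K t : ℝ} (hK : 0 ≤ K) (ht : 0 ≤ t)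
    (hg : IntervalIntegrable g volume 0 t)
    (h : ∀ s ∈ Icc 0 t, K < ∫ r in (0:ℝ)..s, g r → g s ≤ 0) :
    ∫ r in (0:ℝ)..t, g r ≤ K := by
  by_contra! hlt
  have hcont : ContinuousOn (fun s => ∫ r in (0:ℝ)..s, g r) (Icc 0 t) := by
    have := intervalIntegral.continuousOn_primitive_interval' hg left_mem_uIcc
    rwa [uIcc_of_le ht] at this
  set A := Icc 0 t ∩ (fun s => ∫ r in (0:ℝ)..s, g r) ⁻¹' Iic K with hA
  have hAc : IsCompact A :=
    isCompact_Icc.of_isClosed_subset (hcont.preimage_isClosed_of_isClosed isClosed_Icc isClosed_Iic)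
      inter_subset_left
  have hAn : A.Nonempty := ⟨0, ⟨le_rfl, ht⟩, by simpa using hK⟩
  obtain ⟨τ, hτ, hmax⟩ := hAc.exists_isGreatest hAn
  have hτ0 : τ ∈ Icc 0 t := hτ.1
  have hτK : ∫ r in (0:ℝ)..τ, g r ≤ K := hτ.2
  have h1 : IntervalIntegrable g volume 0 τ :=
    hg.mono_set (by rw [uIcc_of_le ht, uIcc_of_le hτ0.1]; exact Icc_subset_Icc_right hτ0.2)
  have h2 : IntervalIntegrable g volume τ t :=
    hg.mono_set (by rw [uIcc_of_le ht, uIcc_of_le hτ0.2]; exact Icc_subset_Icc_left hτ0.1)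
  have hneg : ∫ r in τ..t, g r ≤ 0 := by
    rw [intervalIntegral.integral_of_le hτ0.2]
    refine setIntegral_nonpos measurableSet_Ioc fun s hs => ?_
    have hs' : s ∈ Icc 0 t := ⟨hτ0.1.trans hs.1.le, hs.2⟩
    refine h s hs' ?_
    by_contra! hle
    exact absurd (hmax ⟨hs', hle⟩) (not_le.2 hs.1)
  have := intervalIntegral.integral_add_adjacent_intervals h1 h2
  linarith

/-- The cumulative loss `∑_j μ_ij 𝔍ψ_ij + θ_i 𝔍y_i` of class `i`. -/
noncomputable def loss {I J : Type*} [Fintype J] (μ : I × J → ℝ) (θ : I → ℝ)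
    (ψ : I → J → ℝ → ℝ) (y : I → ℝ → ℝ) (i : I) (t : ℝ) : ℝ :=
  ∑ j, μ (i, j) * 𝔍 (ψ i j) t + θ i * 𝔍 (y i) t

lemma loss_eq_integral {I J : Type*} [Fintype J] {μ : I × J → ℝ} {θ : I → ℝ}
    {ψ : I → J → ℝ → ℝ} {y : I → ℝ → ℝ} {t : ℝ} (hψ : ∀ i j, MeasLBInf (ψ i j)) (hy : ∀ i, MeasLBInf (y i)) (i : I)
    (ht : 0 ≤ t) :
    loss μ θ ψ y i t = ∫ s in (0:ℝ)..t, (∑ j, μ (i, j) * ψ i j s + θ i * y i s) := by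
  have h1 : ∀ j, IntervalIntegrable (fun s => μ (i, j) * ψ i j s) volume 0 t :=
    fun j => ((hψ i j).intervalIntegrable ht).const_mul _
  have h2 : IntervalIntegrable (fun s => ∑ j, μ (i, j) * ψ i j s) volume 0 t := by
    simpa [Finset.sum_fn] using IntervalIntegrable.sum Finset.univ fun j _ => h1 j
  rw [intervalIntegral.integral_add h2 (((hy i).intervalIntegrable ht).const_mul _),
    intervalIntegral.integral_finsetSum fun j _ => h1 j]
  simp [loss, 𝔍]

section

variable {I J : Type*} [Fintype I] [Fintype J] {i₀ : I} {j₀ : J} {μ : I × J → ℝ} {θ : I → ℝ}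
  {ψ : I → J → ℝ → ℝ} {y w : I → ℝ → ℝ} {z : J → ℝ → ℝ} {S : Set ℝ} {t : ℝ}

lemma Sys.sum_psi (h : Sys i₀ j₀ μ θ ψ y w z S) (i : I) (ht : t ∈ S) :
    ∑ j, ψ i j t = w i t - y i t - loss μ θ ψ y i t := by
  have := h.2.1 i t ht
  rw [Finset.sum_add_distrib] at this
  rw [loss]
  linarith

lemma Sys.psi_eq_neg (h : Sys i₀ j₀ μ θ ψ y w z S) {j : J} (hj : j ≠ j₀) (ht : t ∈ S) :
    ψ i₀ j t = -z j t := by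
  rw [← h.2.2.1 j t ht]
  exact (Fintype.sum_eq_single i₀ fun i hi => h.1 i j (by tauto) t ht).symm

/-- The rate of loss of class `i`, expressed through the loss itself. -/
lemma Sys.loss_rate (h : Sys i₀ j₀ μ θ ψ y w z S) (i : I) (ht : t ∈ S) :
    ∑ j, μ (i, j) * ψ i j t + θ i * y i t =
      μ (i, j₀) * (w i t - loss μ θ ψ y i t) - (μ (i, j₀) - θ i) * y i t
        + ∑ j, (μ (i, j) - μ (i, j₀)) * ψ i j t := by
  have := h.sum_psi i ht
  simp only [sub_mul, Finset.sum_sub_distrib, ← Finset.mul_sum, this]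
  ring

lemma Sys.sum_sub_loss (h : Sys i₀ j₀ μ θ ψ y w z S) (ht : t ∈ S) :
    ∑ i, (w i t - loss μ θ ψ y i t) = ∑ i, y i t - ∑ j, z j t := by
  have h1 : ∀ i, w i t - loss μ θ ψ y i t = y i t + ∑ j, ψ i j t := fun i => by
    rw [h.sum_psi i ht]; ring
  have h2 : ∀ j, ∑ i, ψ i j t = -z j t := fun j => h.2.2.1 j t ht
  simp only [h1, Finset.sum_add_distrib]
  rw [Finset.sum_comm]
  simp only [h2, Finset.sum_neg_distrib]
  ring

lemma Sys.loss_le_of_ne (h : Sys i₀ j₀ μ θ ψ y w z (Ici 0))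
    (hψ : ∀ i j, MeasLBInf (ψ i j)) (hy : ∀ i, MeasLBInf (y i)) {i : I} (hi : i ≠ i₀)
    (hμ : 0 ≤ μ (i, j₀)) (hθμ : θ i ≤ μ (i, j₀)) {W : ℝ} (hW : 0 ≤ W) (ht : 0 ≤ t)
    (hw : ∀ s ∈ Icc 0 t, w i s ≤ W) : loss μ θ ψ y i t ≤ W := by
  rw [loss_eq_integral hψ hy i ht]
  refine integral_le_of_integrand_nonpos hW ht ?_ fun s hs hlt => ?_
  · refine IntervalIntegrable.add ?_ (((hy i).intervalIntegrable ht).const_mul _)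
    simpa [Finset.sum_fn] using IntervalIntegrable.sum Finset.univ fun j _ =>
      ((hψ i j).intervalIntegrable ht).const_mul (μ (i, j))
  · rw [← loss_eq_integral hψ hy i hs.1] at hlt
    rw [h.loss_rate i hs.1]
    have h0 : ∑ j, (μ (i, j) - μ (i, j₀)) * ψ i j s = 0 := by
      refine Finset.sum_eq_zero fun j _ => ?_
      by_cases hj : j = j₀
      · simp [hj]
      · rw [h.1 i j (by tauto) s hs.1, mul_zero]
    have h1 : μ (i, j₀) * (w i s - loss μ θ ψ y i s) ≤ 0 :=
      mul_nonpos_of_nonneg_of_nonpos hμ (by linarith [hw s hs])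
    have h2 : 0 ≤ (μ (i, j₀) - θ i) * y i s :=
      mul_nonneg (by linarith) (h.2.2.2.1 i s hs.1)
    linarith

/-- When the loss of every class but `i₀` is bounded by `W`, the total idleness is bounded by
the loss of `i₀`. -/
lemma Sys.sum_z_le (h : Sys i₀ j₀ μ θ ψ y w z S) {W : ℝ} (ht : t ∈ S)
    (hw : ∑ i, |w i t| ≤ W) (hloss : ∀ i ≠ i₀, loss μ θ ψ y i t ≤ W) {L : ℝ}
    (hL : 0 ≤ L) (hL₀ : loss μ θ ψ y i₀ t ≤ L) :
    ∑ j, z j t ≤ L + (Fintype.card I + 1) * W := by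
  classical
  have hW : 0 ≤ W := (Finset.sum_nonneg fun i _ => abs_nonneg (w i t)).trans hw
  have hmin := h.2.2.2.2.2 t ht
  have hsum := h.sum_sub_loss ht
  rcases min_choice (∑ i, y i t) (∑ j, z j t) with hc | hc
  · rw [hc] at hmin
    rw [hmin, Finset.sum_sub_distrib] at hsum
    have h1 : ∑ i, loss μ θ ψ y i t ≤ L + Fintype.card I * W := by
      rw [← Finset.add_sum_erase _ _ (Finset.mem_univ i₀)]
      refine add_le_add hL₀ ?_
      calc ∑ i ∈ Finset.univ.erase i₀, loss μ θ ψ y i t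
          ≤ ∑ i ∈ Finset.univ.erase i₀, W :=
            Finset.sum_le_sum fun i hi => hloss i (Finset.ne_of_mem_erase hi)
        _ ≤ ∑ i : I, W := Finset.sum_le_univ_sum_of_nonneg fun _ => hW
        _ = Fintype.card I * W := by simp
    have h2 : -∑ i, w i t ≤ W :=
      (neg_le_abs _).trans ((Finset.abs_sum_le_sum_abs _ _).trans hw)
    linarith
  · rw [hc] at hmin
    rw [hmin]
    positivity

lemma Sys.loss_root_le (h : Sys i₀ j₀ μ θ ψ y w z (Ici 0))
    (hψ : ∀ i j, MeasLBInf (ψ i j)) (hy : ∀ i, MeasLBInf (y i)) {m : ℝ} (hm : 0 < m)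
    (hμ : ∀ j, m ≤ μ (i₀, j)) (hθμ : θ i₀ ≤ μ (i₀, j₀)) {W : ℝ} (ht : 0 ≤ t)
    (hw : ∀ s ∈ Icc 0 t, ∑ i, |w i s| ≤ W)
    (hloss : ∀ s ∈ Icc 0 t, ∀ i ≠ i₀, loss μ θ ψ y i s ≤ W) :
    loss μ θ ψ y i₀ t ≤ μ (i₀, j₀) * (Fintype.card I + 2) * W / m := by
  have hW : 0 ≤ W :=
    (Finset.sum_nonneg fun i _ => abs_nonneg (w i 0)).trans (hw 0 ⟨le_rfl, ht⟩)
  have hμ₀ : 0 < μ (i₀, j₀) := hm.trans_le (hμ j₀)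
  have hK : 0 ≤ μ (i₀, j₀) * (Fintype.card I + 2) * W / m := by positivity
  rw [loss_eq_integral hψ hy i₀ ht]
  refine integral_le_of_integrand_nonpos hK ht ?_ fun s hs hlt => ?_
  · refine IntervalIntegrable.add ?_ (((hy i₀).intervalIntegrable ht).const_mul _)
    simpa [Finset.sum_fn] using IntervalIntegrable.sum Finset.univ fun j _ =>
      ((hψ i₀ j).intervalIntegrable ht).const_mul (μ (i₀, j))
  · rw [← loss_eq_integral hψ hy i₀ hs.1] at hlt
    rw [h.loss_rate i₀ hs.1]
    set L := loss μ θ ψ y i₀ s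
    have hz := h.sum_z_le hs.1 (hw s hs) (hloss s hs) (hK.trans hlt.le) le_rfl
    have h0 : ∑ j, (μ (i₀, j) - μ (i₀, j₀)) * ψ i₀ j s ≤ (μ (i₀, j₀) - m) * ∑ j, z j s := by
      rw [Finset.mul_sum]
      refine Finset.sum_le_sum fun j _ => ?_
      have hzj : 0 ≤ z j s := h.2.2.2.2.1 j s hs.1
      by_cases hj : j = j₀
      · subst hj
        simpa using mul_nonneg (sub_nonneg.2 (hμ j)) hzj
      · rw [h.psi_eq_neg hj hs.1]
        nlinarith [mul_nonneg (sub_nonneg.2 (hμ j)) hzj]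
    have h1 : (μ (i₀, j₀) - m) * ∑ j, z j s ≤
        (μ (i₀, j₀) - m) * (L + (Fintype.card I + 1) * W) :=
      mul_le_mul_of_nonneg_left hz (sub_nonneg.2 (hμ j₀))
    have h2 : 0 ≤ (μ (i₀, j₀) - θ i₀) * y i₀ s :=
      mul_nonneg (by linarith) (h.2.2.2.1 i₀ s hs.1)
    have h3 : μ (i₀, j₀) * w i₀ s ≤ μ (i₀, j₀) * W :=
      mul_le_mul_of_nonneg_left ((le_abs_self _).trans
        ((Finset.single_le_sum (f := fun i => |w i s|) (fun i _ => abs_nonneg _)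
          (Finset.mem_univ i₀)).trans (hw s hs))) hμ₀.le
    have h4 : μ (i₀, j₀) * (Fintype.card I + 2) * W < L * m := (div_lt_iff₀ hm).1 hlt
    have h5 : 0 ≤ m * ((Fintype.card I + 1) * W) := by positivity
    linarith

/-- If the losses are bounded above by `L` and the total cumulative idleness by `ζ`, then the
losses are bounded in absolute value. -/
lemma Sys.abs_loss_le (h : Sys i₀ j₀ μ θ ψ y w z (Ici 0))
    (hψ : ∀ i j, MeasLBInf (ψ i j)) (hθ : ∀ i, 0 ≤ θ i) {m M : ℝ} (hm : 0 < m)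
    (hμ : ∀ i j, (j = j₀ ∨ i = i₀) → m ≤ μ (i, j)) (hM : ∀ i j, μ (i, j) ≤ M)
    {L ζ : ℝ} (ht : 0 ≤ t) (hL : 0 ≤ L) (hloss : ∀ i, loss μ θ ψ y i t ≤ L)
    (hζ : ∑ j, 𝔍 (z j) t ≤ ζ) (i : I) :
    |loss μ θ ψ y i t| ≤ L + M * (2 * ζ + Fintype.card I * ((L + M * ζ) / m)) := by
  classical
  have hM0 : 0 ≤ M := hm.le.trans ((hμ i₀ j₀ (.inl rfl)).trans (hM i₀ j₀))
  have hZ : ∀ j, 0 ≤ 𝔍 (z j) t := fun j =>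
    intervalIntegral.integral_nonneg ht fun s hs => h.2.2.2.2.1 j s hs.1
  have hY : 0 ≤ θ i * 𝔍 (y i) t := mul_nonneg (hθ i) <|
    intervalIntegral.integral_nonneg ht fun s hs => h.2.2.2.1 i s hs.1
  have hζ0 : 0 ≤ ζ := (Finset.sum_nonneg fun j _ => hZ j).trans hζ
  have hrow : ∀ i, |loss μ θ ψ y i t - θ i * 𝔍 (y i) t - μ (i, j₀) * 𝔍 (ψ i j₀) t| ≤ M * ζ := by
    intro i
    have hj : ∀ j ≠ j₀, |μ (i, j) * 𝔍 (ψ i j) t| ≤ M * 𝔍 (z j) t := by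
      intro j hj
      by_cases hi : i = i₀
      · subst hi
        have : 𝔍 (ψ i j) t = -𝔍 (z j) t := by
          rw [𝔍, 𝔍, ← intervalIntegral.integral_neg]
          refine intervalIntegral.integral_congr fun s hs => ?_
          rw [uIcc_of_le ht] at hs
          exact h.psi_eq_neg hj hs.1
        rw [this, abs_mul, abs_neg, abs_of_nonneg (hZ j),
          abs_of_nonneg (hm.le.trans (hμ i j (.inr rfl)))]
        exact mul_le_mul_of_nonneg_right (hM i j) (hZ j)
      · have : 𝔍 (ψ i j) t = 0 := by
          refine intervalIntegral.integral_zero_ae (.of_forall fun s hs => ?_)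
          rw [uIoc_of_le ht] at hs
          exact h.1 i j (by tauto) s hs.1.le
        rw [this]
        simpa using mul_nonneg hM0 (hZ j)
    have heq : loss μ θ ψ y i t - θ i * 𝔍 (y i) t - μ (i, j₀) * 𝔍 (ψ i j₀) t =
        ∑ j ∈ Finset.univ.erase j₀, μ (i, j) * 𝔍 (ψ i j) t := by
      rw [loss, ← Finset.add_sum_erase _ _ (Finset.mem_univ j₀)]
      ring
    rw [heq]
    calc _ ≤ ∑ j ∈ Finset.univ.erase j₀, |μ (i, j) * 𝔍 (ψ i j) t| :=
          Finset.abs_sum_le_sum_abs _ _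
      _ ≤ ∑ j ∈ Finset.univ.erase j₀, M * 𝔍 (z j) t :=
          Finset.sum_le_sum fun j hj' => hj j (Finset.ne_of_mem_erase hj')
      _ ≤ ∑ j, M * 𝔍 (z j) t :=
          Finset.sum_le_univ_sum_of_nonneg fun j => mul_nonneg hM0 (hZ j)
      _ ≤ M * ζ := by
          rw [← Finset.mul_sum]
          exact mul_le_mul_of_nonneg_left hζ hM0
  set P := (L + M * ζ) / m with hP
  have hP0 : 0 ≤ P := by positivity
  have hV : ∀ k, 𝔍 (ψ k j₀) t ≤ P := by
    intro k
    have hYk : 0 ≤ θ k * 𝔍 (y k) t := mul_nonneg (hθ k) <|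
      intervalIntegral.integral_nonneg ht fun s hs => h.2.2.2.1 k s hs.1
    have h1 := (abs_le.1 (hrow k)).1
    have h2 := hloss k
    rcases le_total (𝔍 (ψ k j₀) t) 0 with hneg | hpos
    · exact hneg.trans hP0
    · rw [hP, le_div_iff₀ hm]
      have := mul_le_mul_of_nonneg_right (hμ k j₀ (.inl rfl)) hpos
      linarith
  have hsum : ∑ k, 𝔍 (ψ k j₀) t = -𝔍 (z j₀) t := by
    simp only [𝔍]
    rw [← intervalIntegral.integral_finsetSum fun k _ => (hψ k j₀).intervalIntegrable ht,
      ← intervalIntegral.integral_neg]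
    refine intervalIntegral.integral_congr fun s hs => ?_
    rw [uIcc_of_le ht] at hs
    exact h.2.2.1 j₀ s hs.1
  have hlow : -(ζ + Fintype.card I * P) ≤ 𝔍 (ψ i j₀) t := by
    rw [← Finset.add_sum_erase _ _ (Finset.mem_univ i)] at hsum
    have h1 : ∑ k ∈ Finset.univ.erase i, 𝔍 (ψ k j₀) t ≤ Fintype.card I * P :=
      calc _ ≤ ∑ k ∈ Finset.univ.erase i, P := Finset.sum_le_sum fun k _ => hV k
        _ ≤ ∑ k : I, P := Finset.sum_le_univ_sum_of_nonneg fun _ => hP0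
        _ = Fintype.card I * P := by simp
    have h2 : 𝔍 (z j₀) t ≤ ζ :=
      (Finset.single_le_sum (fun j _ => hZ j) (Finset.mem_univ j₀)).trans hζ
    linarith
  have hQ : 0 ≤ ζ + Fintype.card I * P := by positivity
  have hμV : -(M * (ζ + Fintype.card I * P)) ≤ μ (i, j₀) * 𝔍 (ψ i j₀) t := by
    have h1 := mul_le_mul_of_nonneg_left hlow (hm.le.trans (hμ i j₀ (.inl rfl)))
    have h2 := mul_le_mul_of_nonneg_right (hM i j₀) hQ
    linarith
  have hMζ : 0 ≤ M * ζ := by positivity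
  have hMQ : 0 ≤ M * (ζ + Fintype.card I * P) := by positivity
  have h1 := (abs_le.1 (hrow i)).1
  rw [abs_le]
  constructor
  · linarith
  · linarith [hloss i]

end

/-- Corollary 2: for a tree of diameter at most 3, if `θ_i ≤ μ_ij` for
every activity `(i,j)`, then every solution of (66)–(69) on `[0,∞)` with `w`
right-continuous satisfies
`∑_i |x_i(t)| ≤ m₄ (1+t)^{m₄} (1 + sup_{0≤s≤t} ∑_i |w_i(s)|)`, where
`x_i = w_i − ∑_j μ_ij 𝔍ψ_ij − θ_i 𝔍y_i`. -/
theorem estimate_diameter_three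
    {I J : Type*} [Fintype I] [Fintype J] [Nonempty I] [Nonempty J]
    (i₀ : I) (j₀ : J) (μ : I × J → ℝ) (θ : I → ℝ)
    (hμpos : ∀ i j, (j = j₀ ∨ i = i₀) → 0 < μ (i, j))
    (hμzero : ∀ i j, ¬(j = j₀ ∨ i = i₀) → μ (i, j) = 0)
    (hθ : ∀ i, 0 ≤ θ i)
    (hθμ : ∀ i j, (j = j₀ ∨ i = i₀) → θ i ≤ μ (i, j)) :
    ∃ m₄ : ℝ, 0 < m₄ ∧
      ∀ (ψ : I → J → ℝ → ℝ) (y w : I → ℝ → ℝ) (z : J → ℝ → ℝ),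
        (∀ i j, MeasLBInf (ψ i j)) → (∀ i, MeasLBInf (y i)) →
        (∀ i, MeasLBInf (w i)) → (∀ j, MeasLBInf (z j)) →
        (∀ i, ∀ t : ℝ, 0 ≤ t → ContinuousWithinAt (w i) (Ici t) t) →
        Sys i₀ j₀ μ θ ψ y w z (Ici (0:ℝ)) →
        ∀ t : ℝ, 0 ≤ t →
          ∑ i, |w i t - ∑ j, μ (i, j) * 𝔍 (ψ i j) t - θ i * 𝔍 (y i) t| ≤
            m₄ * (1 + t) ^ m₄ *
              (1 + sSup ((fun s => ∑ i, |w i s|) '' Icc 0 t)) := by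
  classical
  obtain ⟨m, hm, hμm⟩ : ∃ m : ℝ, 0 < m ∧ ∀ i j, (j = j₀ ∨ i = i₀) → m ≤ μ (i, j) := by
    obtain ⟨p, hp, hmin⟩ := Finset.exists_min_image
      (Finset.univ.filter fun p : I × J => p.2 = j₀ ∨ p.1 = i₀) μ ⟨(i₀, j₀), by simp⟩
    exact ⟨μ p, hμpos p.1 p.2 (by simpa using hp), fun i j hij => hmin (i, j) (by simpa using hij)⟩
  obtain ⟨p, hp⟩ := Finite.exists_max μ
  set M := μ p with hMdef
  have hM : ∀ i j, μ (i, j) ≤ M := fun i j => hp (i, j)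
  have hM0 : 0 < M := (hμpos i₀ j₀ (.inl rfl)).trans_le (hM i₀ j₀)
  set n : ℝ := (Fintype.card I : ℝ) with hn
  have hn0 : 0 ≤ n := by positivity
  set a := 1 + M * (n + 2) / m with ha
  set b := a + (n + 1) with hb
  set C := n * (1 + a + M * (2 * b + n * ((a + M * b) / m))) with hC
  have ha0 : 0 ≤ a := by positivity
  have hb0 : 0 ≤ b := by positivity
  have hC0 : 0 ≤ C := by positivity
  refine ⟨C + 1, by positivity, fun ψ y w z hψ hy hw hz _ h t ht => ?_⟩
  set W := sSup ((fun s => ∑ i, |w i s|) '' Icc 0 t) with hWdef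
  have hbdd : BddAbove ((fun s => ∑ i, |w i s|) '' Icc 0 t) := by
    choose c hc using fun i => (hw i).2 t ht
    refine ⟨∑ i, c i, ?_⟩
    rintro _ ⟨s, hs, rfl⟩
    exact Finset.sum_le_sum fun i _ => hc i s hs
  have hwW : ∀ s ∈ Icc 0 t, ∑ i, |w i s| ≤ W := fun s hs => le_csSup hbdd ⟨s, hs, rfl⟩
  have hwi : ∀ i, ∀ s ∈ Icc 0 t, |w i s| ≤ W := fun i s hs =>
    (Finset.single_le_sum (f := fun i => |w i s|) (fun i _ => abs_nonneg _)
      (Finset.mem_univ i)).trans (hwW s hs)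
  have hW : 0 ≤ W := (abs_nonneg _).trans (hwi i₀ 0 ⟨le_rfl, ht⟩)
  have hsub : ∀ s ∈ Icc 0 t, Icc 0 s ⊆ Icc 0 t := fun s hs => Icc_subset_Icc_right hs.2
  have hleaf : ∀ s ∈ Icc 0 t, ∀ i ≠ i₀, loss μ θ ψ y i s ≤ W := fun s hs i hi =>
    h.loss_le_of_ne hψ hy hi (hμpos i j₀ (.inl rfl)).le (hθμ i j₀ (.inl rfl)) hW hs.1
      fun r hr => (le_abs_self _).trans (hwi i r (hsub s hs hr))
  have hroot : ∀ s ∈ Icc 0 t, loss μ θ ψ y i₀ s ≤ a * W := by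
    intro s hs
    have h1 := h.loss_root_le hψ hy hm (fun j => hμm i₀ j (.inr rfl)) (hθμ i₀ j₀ (.inl rfl)) hs.1
      (fun r hr => hwW r (hsub s hs hr)) fun r hr => hleaf r (hsub s hs hr)
    have h2 : μ (i₀, j₀) * (n + 2) * W / m ≤ M * (n + 2) * W / m := by
      gcongr
      exact hM i₀ j₀
    have h3 : a * W = W + M * (n + 2) * W / m := by rw [ha]; ring
    linarith
  have hall : ∀ i, loss μ θ ψ y i t ≤ a * W := by
    intro i
    by_cases hi : i = i₀
    · rw [hi]
      exact hroot t ⟨ht, le_rfl⟩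
    · have h3 : a * W = W + M * (n + 2) / m * W := by rw [ha]; ring
      have h4 : 0 ≤ M * (n + 2) / m * W := by positivity
      linarith [hleaf t ⟨ht, le_rfl⟩ i hi]
  have hZ : ∑ j, 𝔍 (z j) t ≤ b * W * (1 + t) := by
    simp only [𝔍]
    rw [← intervalIntegral.integral_finsetSum fun j _ => (hz j).intervalIntegrable ht]
    have h1 : ∫ s in (0:ℝ)..t, ∑ j, z j s ≤ ∫ s in (0:ℝ)..t, b * W := by
      refine intervalIntegral.integral_mono_on ht ?_ intervalIntegrable_const fun s hs => ?_
      · simpa [Finset.sum_fn] using IntervalIntegrable.sum Finset.univ fun j _ =>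
          (hz j).intervalIntegrable ht
      · have := h.sum_z_le hs.1 (hwW s hs) (hleaf s hs) (by positivity) (hroot s hs)
        rw [hb, add_mul]
        exact this
    rw [intervalIntegral.integral_const, smul_eq_mul, sub_zero] at h1
    have : 0 ≤ b * W := by positivity
    linarith
  have haW : a * W ≤ a * W * (1 + t) := le_mul_of_one_le_right (by positivity) (by linarith)
  have habs := h.abs_loss_le hψ hθ hm hμm hM ht (by positivity : 0 ≤ a * W * (1 + t))
    (fun i => (hall i).trans haW) hZ
  have hterm : ∀ i, |w i t - ∑ j, μ (i, j) * 𝔍 (ψ i j) t - θ i * 𝔍 (y i) t| ≤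
      (1 + a + M * (2 * b + n * ((a + M * b) / m))) * (W * (1 + t)) := by
    intro i
    have h1 : w i t - ∑ j, μ (i, j) * 𝔍 (ψ i j) t - θ i * 𝔍 (y i) t =
        w i t - loss μ θ ψ y i t := by
      rw [loss]; ring
    have h2 : W ≤ W * (1 + t) := le_mul_of_one_le_right hW (by linarith)
    rw [h1]
    calc |w i t - loss μ θ ψ y i t| ≤ |w i t| + |loss μ θ ψ y i t| := abs_sub _ _
      _ ≤ W * (1 + t) + _ := add_le_add ((hwi i t ⟨ht, le_rfl⟩).trans h2) (habs i)
      _ = _ := by ring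
  have hpow : 1 + t ≤ (1 + t) ^ (C + 1) :=
    Real.self_le_rpow_of_one_le (by linarith) (by linarith)
  calc ∑ i, |w i t - ∑ j, μ (i, j) * 𝔍 (ψ i j) t - θ i * 𝔍 (y i) t|
      ≤ ∑ _i : I, (1 + a + M * (2 * b + n * ((a + M * b) / m))) * (W * (1 + t)) :=
        Finset.sum_le_sum fun i _ => hterm i
    _ = C * (1 + t) * W := by
        rw [Finset.sum_const, Finset.card_univ, nsmul_eq_mul, hC]
        ring
    _ ≤ (C + 1) * (1 + t) ^ (C + 1) * (1 + W) := by
        gcongr <;> linarith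
end
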